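/- arXiv:1506.05520 — 2 statements merged into one kernel-verified Lean document; each statement's English description precedes it below -/
import Mathlib

section
/- Existence of gradient flows (main existence theorem): let f₀ be a compactly supported Borel probability measure on ℝ² with supp(f₀) ⊂ B_{R_x} × B_{R_v} whose spatial marginal ρ₀ is atomless, let G₀(x) = f₀((−∞,x] × ℝ), let η₀ be the push-forward of f₀ by (x, v) ↦ (x, v + G₀(x)), let μ be a σ-finite measure with respect to which the second marginal of η₀ is absolutely continuous, and let ν₀ = (ν₀^a)_{a∈A} with η₀ = ν₀^a ⊗ μ be the disintegration of η₀. Then for every T > 0 there exists a gradient flow of J on [0, T] starting from ν₀; in particular there exists a measure solution of the system ∂ₜν^a + ∂ₓ(ν^a v^a) = 0, v_t^a(x) ∈ [a − G_t(x), a − G_t⁻(x)], ρ_t = ∫_A ν_t^a dμ(a), G_t(x) = ρ_t((−∞,x]), G_t⁻(x) = ρ_t((−∞,x)), with initial condition ν₀. -/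
open MeasureTheory Filter

noncomputable section

/-- Optimal transport cost between two Borel measures on `E` for the cost `c`:
the infimum of `∫ c(x,y) dγ` over all transport plans `γ` with marginals `ν` and `θ`. -/
def Wcost {E : Type*} [MeasurableSpace E] (c : E → E → ℝ) (ν θ : Measure E) : ℝ :=
  sInf { r : ℝ | ∃ γ : Measure (E × E),
    γ.map Prod.fst = ν ∧ γ.map Prod.snd = θ ∧ r = ∫ p, c p.1 p.2 ∂γ }

/-- Squared 2-Wasserstein distance between measures (of equal mass) on `ℝ`. -/
def W2sq (ν θ : Measure ℝ) : ℝ := Wcost (fun x y => (x - y) ^ 2) ν θ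

/-- Squared 2-Wasserstein distance between measures on `ℝ × ℝ` (Euclidean cost). -/
def W2sqProd (ν θ : Measure (ℝ × ℝ)) : ℝ :=
  Wcost (fun p q => (p.1 - q.1) ^ 2 + (p.2 - q.2) ^ 2) ν θ

/-- The measure `ν ⊗ μ` on `A × ℝ` associated with a family `ν = (ν^a)` of measures on `ℝ`:
`∫ φ d(ν⊗μ) = ∫_A ∫_ℝ φ(a,x) dν^a(x) dμ(a)`. -/
def nuOtimes (μ : Measure ℝ) (ν : ℝ → Measure ℝ) : Measure (ℝ × ℝ) :=
  μ.bind fun a => (ν a).map fun x => (a, x)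

/-- Membership in `X_R`: a `μ`-measurable family `ν = (ν^a)` of nonnegative measures on `ℝ`
with total mass `h a` for `μ`-a.e. `a` and support in `[-R, R]` for `μ`-a.e. `a`. -/
structure IsXR (μ : Measure ℝ) (h : ℝ → ℝ) (R : ℝ) (ν : ℝ → Measure ℝ) : Prop where
  meas : ∀ s : Set ℝ, MeasurableSet s → Measurable fun a => ν a s
  mass : ∀ᵐ a ∂μ, ν a Set.univ = ENNReal.ofReal (h a)
  supp : ∀ᵐ a ∂μ, ν a ((Set.Icc (-R) R)ᶜ) = 0

/-- The measure `ν̄ = ∫_A ν^a dμ(a)` (second marginal of `ν ⊗ μ`). -/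
def barNu (μ : Measure ℝ) (ν : ℝ → Measure ℝ) : Measure ℝ := (nuOtimes μ ν).map Prod.snd

/-- The interaction part `J₀(ν) = ∫∫ |x−y| d(ν⊗μ)(a,x) d(ν⊗μ)(b,y)`. -/
def J0 (μ : Measure ℝ) (ν : ℝ → Measure ℝ) : ℝ :=
  ∫ q, |q.1.2 - q.2.2| ∂((nuOtimes μ ν).prod (nuOtimes μ ν))

/-- The potential part `J₁(ν) = ∫ (1/2 − a)·x d(ν⊗μ)(a,x)`. -/
def J1 (μ : Measure ℝ) (ν : ℝ → Measure ℝ) : ℝ :=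
  ∫ p, (1 / 2 - p.1) * p.2 ∂(nuOtimes μ ν)

/-- The energy `J = (1/4)·J₀ + J₁`. -/
def Jen (μ : Measure ℝ) (ν : ℝ → Measure ℝ) : ℝ := (1 / 4) * J0 μ ν + J1 μ ν

/-- The squared distance `d²(ν, θ) = ∫_A W₂²(ν^a, θ^a) dμ(a)` on `X_R`. -/
def dsq (μ : Measure ℝ) (ν θ : ℝ → Measure ℝ) : ℝ := ∫ a, W2sq (ν a) (θ a) ∂μ

/-- The weak distance `d_w(ν, θ) = W₂(ν⊗μ, θ⊗μ)`. -/
def dw (μ : Measure ℝ) (ν θ : ℝ → Measure ℝ) : ℝ :=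
  Real.sqrt (W2sqProd (nuOtimes μ ν) (nuOtimes μ θ))

/-- A `μ`-measurable family of transport plans `γ^a ∈ Π(ν^a, θ^a)`. -/
structure IsPlanFamily (μ : Measure ℝ) (ν θ : ℝ → Measure ℝ)
    (γ : ℝ → Measure (ℝ × ℝ)) : Prop where
  meas : ∀ s : Set (ℝ × ℝ), MeasurableSet s → Measurable fun a => γ a s
  fst : ∀ᵐ a ∂μ, (γ a).map Prod.fst = ν a
  snd : ∀ᵐ a ∂μ, (γ a).map Prod.snd = θ a

/-- `w ∈ ∂J(ν)`: `w ∈ L¹(ν⊗μ)` and for every `R' > 0`, every `θ ∈ X_{R'}` and every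
`μ`-measurable family of plans `γ^a ∈ Π(ν^a, θ^a)`,
`J(θ) − J(ν) ≥ ∫_A ∫ w^a(y)(z − y) dγ^a(y,z) dμ(a)`. -/
def InSubdiff (μ : Measure ℝ) (h : ℝ → ℝ) (ν : ℝ → Measure ℝ) (w : ℝ → ℝ → ℝ) : Prop :=
  Integrable (fun p : ℝ × ℝ => w p.1 p.2) (nuOtimes μ ν) ∧
  ∀ R' : ℝ, 0 < R' → ∀ θ : ℝ → Measure ℝ, IsXR μ h R' θ →
    ∀ γ : ℝ → Measure (ℝ × ℝ), IsPlanFamily μ ν θ γ →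
      Jen μ θ - Jen μ ν ≥ ∫ a, (∫ p : ℝ × ℝ, w a p.1 * (p.2 - p.1) ∂(γ a)) ∂μ

/-- Cumulative distribution function `G(x) = ρ((−∞, x])` of `ρ = ∫_A ν^a dμ(a)`. -/
def Gcdf (μ : Measure ℝ) (ν : ℝ → Measure ℝ) (x : ℝ) : ℝ := (barNu μ ν (Set.Iic x)).toReal

/-- Left-continuous version `G⁻(x) = ρ((−∞, x))`. -/
def GcdfM (μ : Measure ℝ) (ν : ℝ → Measure ℝ) (x : ℝ) : ℝ := (barNu μ ν (Set.Iio x)).toReal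

/-- The curve `t ↦ ν_t` solves the continuity equation `∂ₜν + ∂ₓ(ν v) = 0` on `[0,T]`
in the sense of distributions. -/
def SolvesContinuity (T : ℝ) (νa : ℝ → Measure ℝ) (va : ℝ → ℝ → ℝ) : Prop :=
  ∀ φ : ℝ → ℝ → ℝ, ContDiff ℝ 1 (Function.uncurry φ) →
    HasCompactSupport (Function.uncurry φ) →
    (∫ t in Set.Icc (0 : ℝ) T,
        ∫ x, (deriv (fun s => φ s x) t + deriv (fun y => φ t y) x * va t x) ∂(νa t))
      = (∫ x, φ T x ∂(νa T)) - ∫ x, φ 0 x ∂(νa 0)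

/-- A gradient flow of `J` on `[0,T]` starting from `ν₀`: a Lipschitz (for `d`) curve
`t ↦ ν(t) ∈ X_R` with a velocity `v(t) ∈ −∂J(ν(t))` for a.e. `t`, such that for `μ`-a.e.
label `a` the curve `t ↦ ν(t)^a` solves the continuity equation with velocity `v^a`. -/
structure IsGradientFlow (μ : Measure ℝ) (h : ℝ → ℝ) (R T : ℝ)
    (ν : ℝ → ℝ → Measure ℝ) (v : ℝ → ℝ → ℝ → ℝ) (ν₀ : ℝ → Measure ℝ) : Prop where
  init : ν 0 = ν₀
  mem : ∀ t ∈ Set.Icc (0 : ℝ) T, IsXR μ h R (ν t)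
  lip : ∃ L : ℝ, ∀ s ∈ Set.Icc (0 : ℝ) T, ∀ t ∈ Set.Icc (0 : ℝ) T,
    Real.sqrt (dsq μ (ν s) (ν t)) ≤ L * |t - s|
  vmeas : Measurable fun p : ℝ × ℝ × ℝ => v p.1 p.2.1 p.2.2
  subdiff : ∀ᵐ t ∂(volume.restrict (Set.Icc (0 : ℝ) T)),
    InSubdiff μ h (ν t) fun a x => -(v t a x)
  cont : ∀ᵐ a ∂μ, SolvesContinuity T (fun t => ν t a) fun t => v t a

end

theorem measurable_real_sign : Measurable Real.sign := by
  unfold Real.sign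
  exact Measurable.ite measurableSet_Iio measurable_const
    (Measurable.ite measurableSet_Ioi measurable_const measurable_const)

theorem abs_real_sign_le (r : ℝ) : |Real.sign r| ≤ 1 := by
  rcases Real.sign_apply_eq r with h | h | h <;> simp [h]

theorem real_sign_mul_le_abs (r s : ℝ) : Real.sign r * s ≤ |s| := by
  calc Real.sign r * s ≤ |Real.sign r * s| := le_abs_self _
    _ = |Real.sign r| * |s| := abs_mul _ _
    _ ≤ 1 * |s| := by gcongr; exact abs_real_sign_le r
    _ = |s| := one_mul _

section Lagrangian

variable {Ω : Type*} [MeasurableSpace Ω] (P : Measure Ω)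

/-- The centred mid-rank `(G(X) + G⁻(X) - 1) / 2` of a random variable `X` with distribution
function `G`, written as `1/2 ∫ sign (X ω - X ω') dP(ω')`. -/
noncomputable def midRank (X : Ω → ℝ) (ω : Ω) : ℝ :=
  (1 / 2) * ∫ ω', Real.sign (X ω - X ω') ∂P

/-- Gini's mean difference `∫∫ |Z ω - Z ω'| dP dP`. -/
noncomputable def meanDiff (Z : Ω → ℝ) : ℝ := ∫ q, |Z q.1 - Z q.2| ∂(P.prod P)

/-- A bounded field `g` satisfying the subgradient inequality at infinity of `meanDiff / 4`. -/
def IsDominated (g : Ω → ℝ) : Prop :=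
  ∀ Z : Ω → ℝ, Measurable Z → Integrable Z P → ∫ ω, g ω * Z ω ∂P ≤ 1 / 4 * meanDiff P Z

variable {P} {X Y Z : Ω → ℝ}

theorem measurable_sign_sub (hX : Measurable X) :
    Measurable fun q : Ω × Ω => Real.sign (X q.1 - X q.2) :=
  measurable_real_sign.comp ((hX.comp measurable_fst).sub (hX.comp measurable_snd))

theorem measurable_midRank [SFinite P] (hX : Measurable X) : Measurable (midRank P X) :=
  ((measurable_sign_sub hX).stronglyMeasurable.integral_prod_right).measurable.const_mul _

theorem abs_midRank_le [IsProbabilityMeasure P] (ω : Ω) : |midRank P X ω| ≤ 1 / 2 := by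
  have : ‖∫ ω', Real.sign (X ω - X ω') ∂P‖ ≤ 1 * P.real Set.univ :=
    norm_integral_le_of_norm_le_const (Eventually.of_forall fun ω' => abs_real_sign_le _)
  rw [midRank, abs_mul]
  simp at this
  rw [abs_of_pos (by norm_num : (0 : ℝ) < 1 / 2)]
  linarith

theorem integrable_sign_mul (hX : Measurable X) {F : Ω × Ω → ℝ} (hF : Integrable F (P.prod P)) :
    Integrable (fun q : Ω × Ω => Real.sign (X q.1 - X q.2) * F q) (P.prod P) :=
  hF.bdd_mul (c := 1) (measurable_sign_sub hX).aestronglyMeasurable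
    (Eventually.of_forall fun _ => abs_real_sign_le _)

variable [IsProbabilityMeasure P]

theorem integrable_sub_prod (hZ : Integrable Z P) :
    Integrable (fun q : Ω × Ω => Z q.1 - Z q.2) (P.prod P) :=
  (hZ.comp_fst P).sub (hZ.comp_snd P)

theorem integral_midRank_mul (hX : Measurable X) (hZ : Integrable Z P) :
    ∫ ω, midRank P X ω * Z ω ∂P =
      1 / 4 * ∫ q, Real.sign (X q.1 - X q.2) * (Z q.1 - Z q.2) ∂(P.prod P) := by
  have h1 := integrable_sign_mul hX (hZ.comp_fst P)
  have h2 := integrable_sign_mul hX (hZ.comp_snd P)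
  have e1 : ∫ q, Real.sign (X q.1 - X q.2) * Z q.1 ∂(P.prod P)
      = 2 * ∫ ω, midRank P X ω * Z ω ∂P := by
    rw [integral_prod _ h1, ← integral_const_mul]
    congr 1 with ω
    simp only [integral_mul_const, midRank]; ring
  have e2 : ∫ q, Real.sign (X q.1 - X q.2) * Z q.2 ∂(P.prod P)
      = - ∫ q, Real.sign (X q.1 - X q.2) * Z q.1 ∂(P.prod P) := by
    rw [← integral_prod_swap, ← integral_neg]
    congr 1 with q
    simp only [Prod.fst_swap, Prod.snd_swap]
    rw [← neg_sub (X q.1), Real.sign_neg]; ring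
  simp only [mul_sub]
  rw [integral_sub h1 h2, e2, e1]; ring

theorem isDominated_midRank (hX : Measurable X) : IsDominated P (midRank P X) := by
  intro Z hZm hZ
  rw [integral_midRank_mul hX hZ, meanDiff]
  have := integral_mono (integrable_sign_mul hX (integrable_sub_prod hZ))
    (integrable_sub_prod hZ).abs fun q => real_sign_mul_le_abs _ _
  linarith

theorem integral_midRank_mul_self (hX : Measurable X) (hXi : Integrable X P) :
    ∫ ω, midRank P X ω * X ω ∂P = 1 / 4 * meanDiff P X := by
  rw [integral_midRank_mul hX hXi, meanDiff]
  congr 2 with q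
  rw [mul_comm]
  rcases lt_trichotomy (X q.1 - X q.2) 0 with h | h | h
  · rw [Real.sign_of_neg h, abs_of_neg h]; ring
  · simp [h]
  · rw [Real.sign_of_pos h, abs_of_pos h]; ring

theorem integrable_midRank_mul (hX : Measurable X) (hZ : Integrable Z P) :
    Integrable (fun ω => midRank P X ω * Z ω) P :=
  hZ.bdd_mul (c := 1 / 2) (measurable_midRank hX).aestronglyMeasurable
    (Eventually.of_forall fun _ => abs_midRank_le _)

theorem integral_midRank_sub_mul_sub_nonneg (hX : Measurable X) (hY : Measurable Y)
    (hXi : Integrable X P) (hYi : Integrable Y P) :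
    0 ≤ ∫ ω, (midRank P X ω - midRank P Y ω) * (X ω - Y ω) ∂P := by
  have e : ∀ ω, (midRank P X ω - midRank P Y ω) * (X ω - Y ω) =
      (midRank P X ω * X ω - midRank P X ω * Y ω) +
      (midRank P Y ω * Y ω - midRank P Y ω * X ω) := fun ω => by ring
  have hXX := integrable_midRank_mul hX hXi
  have hXY := integrable_midRank_mul hX hYi
  have hYX := integrable_midRank_mul hY hXi
  have hYY := integrable_midRank_mul hY hYi
  have hX' : Integrable (fun ω => midRank P X ω * X ω - midRank P X ω * Y ω) P := hXX.sub hXY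
  have hY' : Integrable (fun ω => midRank P Y ω * Y ω - midRank P Y ω * X ω) P := hYY.sub hYX
  simp only [e]
  rw [integral_add hX' hY', integral_sub hXX hXY, integral_sub hYY hYX,
    integral_midRank_mul_self hX hXi, integral_midRank_mul_self hY hYi]
  have := isDominated_midRank (P := P) hX Y hY hYi
  have := isDominated_midRank (P := P) hY X hX hXi
  linarith

end Lagrangian

section Euler

variable {Ω : Type*} [MeasurableSpace Ω]

/-- The explicit Euler scheme with step `τ` for `dX/dt = β - midRank X`. -/
noncomputable def eulerSeq (P : Measure Ω) (β x₀ : Ω → ℝ) (τ : ℝ) : ℕ → Ω → ℝ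
  | 0 => x₀
  | k + 1 => fun ω => eulerSeq P β x₀ τ k ω + τ * (β ω - midRank P (eulerSeq P β x₀ τ k) ω)

variable {P : Measure Ω} {β x₀ : Ω → ℝ} {τ B : ℝ}

theorem eulerSeq_succ (k : ℕ) (ω : Ω) : eulerSeq P β x₀ τ (k + 1) ω =
    eulerSeq P β x₀ τ k ω + τ * (β ω - midRank P (eulerSeq P β x₀ τ k) ω) := rfl

/-- Linear interpolation, on the grid of step `τ`, of the Euler scheme of step `4 τ`. -/
noncomputable def eulerInterp (P : Measure Ω) (β x₀ : Ω → ℝ) (τ : ℝ) (j : ℕ) (ω : Ω) : ℝ :=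
  eulerSeq P β x₀ (4 * τ) (j / 4) ω +
    (j % 4 : ℕ) * τ * (β ω - midRank P (eulerSeq P β x₀ (4 * τ) (j / 4)) ω)

theorem eulerInterp_succ (j : ℕ) (ω : Ω) : eulerInterp P β x₀ τ (j + 1) ω =
    eulerInterp P β x₀ τ j ω + τ * (β ω - midRank P (eulerSeq P β x₀ (4 * τ) (j / 4)) ω) := by
  unfold eulerInterp
  by_cases h : j % 4 = 3
  · have h1 : (j + 1) / 4 = j / 4 + 1 := by omega
    have h2 : (j + 1) % 4 = 0 := by omega
    rw [h1, h2, h, eulerSeq_succ]; push_cast; ring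
  · have h1 : (j + 1) / 4 = j / 4 := by omega
    have h2 : (j + 1) % 4 = j % 4 + 1 := by omega
    rw [h1, h2]; push_cast; ring

/-- The accumulated rank term between steps `i` and `i + m` of the Euler scheme. -/
noncomputable def eulerDefect (P : Measure Ω) (β x₀ : Ω → ℝ) (τ : ℝ) (i m : ℕ) (ω : Ω) : ℝ :=
  m * τ * β ω - (eulerSeq P β x₀ τ (i + m) ω - eulerSeq P β x₀ τ i ω)

theorem eulerDefect_succ (i m : ℕ) (ω : Ω) : eulerDefect P β x₀ τ i (m + 1) ω =
    eulerDefect P β x₀ τ i m ω + τ * midRank P (eulerSeq P β x₀ τ (i + m)) ω := by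
  rw [eulerDefect, eulerDefect, ← add_assoc, eulerSeq_succ]; push_cast; ring

variable [IsProbabilityMeasure P]

theorem measurable_eulerSeq (hβ : Measurable β) (hx : Measurable x₀) (k : ℕ) :
    Measurable (eulerSeq P β x₀ τ k) := by
  induction k with
  | zero => exact hx
  | succ k ih => exact ih.add ((hβ.sub (measurable_midRank ih)).const_mul τ)

theorem abs_drift_le (hB : ∀ ω, |β ω| ≤ B) (X : Ω → ℝ) (ω : Ω) :
    |β ω - midRank P X ω| ≤ B + 1 / 2 := by
  have h1 := abs_midRank_le (P := P) (X := X) ω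
  have h2 := abs_sub (β ω) (midRank P X ω)
  linarith [hB ω]

theorem abs_eulerSeq_add_sub_le (hB : ∀ ω, |β ω| ≤ B) (hτ : 0 ≤ τ) (j m : ℕ) (ω : Ω) :
    |eulerSeq P β x₀ τ (j + m) ω - eulerSeq P β x₀ τ j ω| ≤ (B + 1 / 2) * (m * τ) := by
  induction m with
  | zero => simp
  | succ m ih =>
    have h1 := abs_drift_le (P := P) hB (eulerSeq P β x₀ τ (j + m)) ω
    rw [← add_assoc, eulerSeq_succ]
    have h2 : |τ * (β ω - midRank P (eulerSeq P β x₀ τ (j + m)) ω)| ≤ τ * (B + 1 / 2) := by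
      rw [abs_mul, abs_of_nonneg hτ]; gcongr
    have h3 := abs_add_le (eulerSeq P β x₀ τ (j + m) ω - eulerSeq P β x₀ τ j ω)
      (τ * (β ω - midRank P (eulerSeq P β x₀ τ (j + m)) ω))
    rw [add_sub_right_comm]
    push_cast
    linarith

theorem integrable_eulerSeq (hβ : Measurable β) (hB : ∀ ω, |β ω| ≤ B) (hx : Measurable x₀)
    (hxi : Integrable x₀ P) (k : ℕ) : Integrable (eulerSeq P β x₀ τ k) P := by
  induction k with
  | zero => exact hxi
  | succ k ih =>
    refine ih.add (Integrable.const_mul ?_ τ)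
    exact Integrable.of_bound
      (hβ.sub (measurable_midRank (measurable_eulerSeq hβ hx k))).aestronglyMeasurable
      (B + 1 / 2) (Eventually.of_forall fun ω => abs_drift_le hB _ ω)

/-- One step of the comparison of a frozen flow with an explicit Euler step. -/
theorem integral_sq_step_le {X Y D : Ω → ℝ} (hX : Measurable X) (hY : Measurable Y)
    (hXi : Integrable X P) (hYi : Integrable Y P) (hD : Measurable D) {M δ : ℝ}
    (hM : ∀ ω, |D ω| ≤ M) (hδ : ∀ ω, |D ω - (X ω - Y ω)| ≤ δ) (hτ : 0 ≤ τ) :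
    ∫ ω, (D ω + τ * (midRank P Y ω - midRank P X ω)) ^ 2 ∂P ≤
      ∫ ω, D ω ^ 2 ∂P + (2 * τ * δ + τ ^ 2) := by
  have hmX := measurable_midRank (P := P) hX
  have hmY := measurable_midRank (P := P) hY
  have hS : ∀ ω, |midRank P X ω - midRank P Y ω| ≤ 1 := fun ω => by
    have h1 := abs_midRank_le (P := P) (X := X) ω
    have h2 := abs_midRank_le (P := P) (X := Y) ω
    linarith [abs_sub (midRank P X ω) (midRank P Y ω)]
  have hD2 : Integrable (fun ω => D ω ^ 2) P :=
    Integrable.of_bound (hD.pow_const 2).aestronglyMeasurable (M ^ 2)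
      (Eventually.of_forall fun ω => by
        rw [Real.norm_eq_abs, abs_pow]; gcongr; exact hM ω)
  have hmon : Integrable (fun ω => (midRank P X ω - midRank P Y ω) * (X ω - Y ω)) P :=
    (hXi.sub hYi).bdd_mul (c := 1) (hmX.sub hmY).aestronglyMeasurable (Eventually.of_forall hS)
  have hr : Integrable (fun ω => D ω ^ 2 + (2 * τ * δ + τ ^ 2)) P := hD2.add (integrable_const _)
  have hrm : Integrable (fun ω =>
      2 * τ * ((midRank P X ω - midRank P Y ω) * (X ω - Y ω))) P := hmon.const_mul _
  have hnn := integral_midRank_sub_mul_sub_nonneg (P := P) hX hY hXi hYi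
  calc ∫ ω, (D ω + τ * (midRank P Y ω - midRank P X ω)) ^ 2 ∂P
      ≤ ∫ ω, ((D ω ^ 2 + (2 * τ * δ + τ ^ 2))
          - 2 * τ * ((midRank P X ω - midRank P Y ω) * (X ω - Y ω))) ∂P := by
        refine integral_mono_of_nonneg (Eventually.of_forall fun ω => sq_nonneg _)
          (hr.sub hrm) (Eventually.of_forall fun ω => ?_)
        set s := midRank P X ω - midRank P Y ω with hs
        have e : midRank P Y ω - midRank P X ω = -s := by rw [hs]; ring
        have h1 : -(s * (D ω - (X ω - Y ω))) ≤ δ := by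
          calc -(s * (D ω - (X ω - Y ω))) ≤ |s * (D ω - (X ω - Y ω))| := neg_le_abs _
            _ = |s| * |D ω - (X ω - Y ω)| := abs_mul _ _
            _ ≤ 1 * δ := mul_le_mul (hS ω) (hδ ω) (abs_nonneg _) zero_le_one
            _ = δ := one_mul _
        have h2 : s ^ 2 ≤ 1 := (sq_le_one_iff_abs_le_one s).2 (hS ω)
        simp only [e]
        nlinarith [mul_le_mul_of_nonneg_left h1 hτ, mul_le_mul_of_nonneg_left h2 (sq_nonneg τ)]
    _ = ∫ ω, D ω ^ 2 ∂P + (2 * τ * δ + τ ^ 2)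
          - 2 * τ * ∫ ω, (midRank P X ω - midRank P Y ω) * (X ω - Y ω) ∂P := by
        rw [integral_sub hr hrm, integral_add hD2 (integrable_const _), integral_const_mul]
        simp
    _ ≤ _ := by
        have := mul_nonneg (mul_nonneg zero_le_two hτ) hnn
        linarith

theorem abs_eulerInterp_sub_le (hB : ∀ ω, |β ω| ≤ B) (hτ : 0 ≤ τ) (j : ℕ) (ω : Ω) :
    |eulerInterp P β x₀ τ j ω - eulerSeq P β x₀ (4 * τ) (j / 4) ω| ≤ 4 * τ * (B + 1 / 2) := by
  have h1 := abs_drift_le (P := P) hB (eulerSeq P β x₀ (4 * τ) (j / 4)) ω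
  have h2 : ((j % 4 : ℕ) : ℝ) ≤ 4 := by
    exact_mod_cast (Nat.mod_lt j (by norm_num)).le
  rw [eulerInterp, add_sub_cancel_left, abs_mul, abs_mul, abs_of_nonneg hτ, Nat.abs_cast]
  gcongr

theorem measurable_eulerInterp (hβ : Measurable β) (hx : Measurable x₀) (j : ℕ) :
    Measurable (eulerInterp P β x₀ τ j) := by
  have h := measurable_eulerSeq (P := P) (τ := 4 * τ) hβ hx (j / 4)
  exact h.add ((hβ.sub (measurable_midRank h)).const_mul _)

theorem abs_eulerInterp_sub_eulerSeq_le (j : ℕ) (hτ : 0 ≤ τ) (ω : Ω) :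
    |eulerInterp P β x₀ τ j ω - eulerSeq P β x₀ τ j ω| ≤ j * τ := by
  induction j with
  | zero => simp [eulerInterp, eulerSeq]
  | succ j ih =>
    have h1 := abs_midRank_le (P := P) (X := eulerSeq P β x₀ (4 * τ) (j / 4)) ω
    have h2 := abs_midRank_le (P := P) (X := eulerSeq P β x₀ τ j) ω
    rw [eulerInterp_succ, eulerSeq_succ]
    rw [abs_le] at *
    push_cast
    constructor <;> nlinarith

theorem integral_sq_eulerInterp_sub_le (hβ : Measurable β) (hB : ∀ ω, |β ω| ≤ B)
    (hx : Measurable x₀) (hxi : Integrable x₀ P) (hτ : 0 ≤ τ) (j : ℕ) :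
    ∫ ω, (eulerInterp P β x₀ τ j ω - eulerSeq P β x₀ τ j ω) ^ 2 ∂P ≤
      j * (τ ^ 2 * (8 * B + 5)) := by
  induction j with
  | zero => simp [eulerInterp, eulerSeq]
  | succ j ih =>
    have h := integral_sq_step_le (P := P) (τ := τ)
      (measurable_eulerSeq (P := P) (τ := 4 * τ) hβ hx (j / 4))
      (measurable_eulerSeq (P := P) (τ := τ) hβ hx j)
      (integrable_eulerSeq hβ hB hx hxi (j / 4)) (integrable_eulerSeq hβ hB hx hxi j)
      ((measurable_eulerInterp (P := P) (τ := τ) hβ hx j).sub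
        (measurable_eulerSeq (P := P) (τ := τ) hβ hx j))
      (abs_eulerInterp_sub_eulerSeq_le j hτ)
      (δ := 4 * τ * (B + 1 / 2))
      (fun ω => by
        have := abs_eulerInterp_sub_le (P := P) (x₀ := x₀) hB hτ j ω
        simpa using this) hτ
    have e : ∀ ω, eulerInterp P β x₀ τ (j + 1) ω - eulerSeq P β x₀ τ (j + 1) ω =
        (eulerInterp P β x₀ τ j - eulerSeq P β x₀ τ j) ω + τ * (midRank P (eulerSeq P β x₀ τ j) ω
          - midRank P (eulerSeq P β x₀ (4 * τ) (j / 4)) ω) := fun ω => by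
      rw [eulerInterp_succ, eulerSeq_succ, Pi.sub_apply]; ring
    simp only [e]
    refine h.trans ?_
    simp only [Pi.sub_apply]
    push_cast
    nlinarith

theorem integral_abs_eulerSeq_refine_le (hβ : Measurable β) (hB : ∀ ω, |β ω| ≤ B)
    (hx : Measurable x₀) (hxi : Integrable x₀ P) (hτ : 0 ≤ τ) (j : ℕ) {ε : ℝ} (hε : 0 < ε) :
    ∫ ω, |eulerSeq P β x₀ τ j ω - eulerSeq P β x₀ (4 * τ) (j / 4) ω| ∂P ≤
      j * (τ ^ 2 * (8 * B + 5)) / ε + ε + 4 * τ * (B + 1 / 2) := by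
  have hsq := integral_sq_eulerInterp_sub_le hβ hB hx hxi hτ j
  set D := fun ω => eulerInterp P β x₀ τ j ω - eulerSeq P β x₀ τ j ω with hD
  have hDm : Measurable D :=
    (measurable_eulerInterp (P := P) (τ := τ) hβ hx j).sub (measurable_eulerSeq hβ hx j)
  have hD2 : Integrable (fun ω => D ω ^ 2) P :=
    Integrable.of_bound (hDm.pow_const 2).aestronglyMeasurable ((j * τ) ^ 2)
      (Eventually.of_forall fun ω => by
        rw [Real.norm_eq_abs, abs_pow]; gcongr; exact abs_eulerInterp_sub_eulerSeq_le j hτ ω)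
  have hD2' : Integrable (fun ω => D ω ^ 2 / ε) P := hD2.div_const ε
  calc ∫ ω, |eulerSeq P β x₀ τ j ω - eulerSeq P β x₀ (4 * τ) (j / 4) ω| ∂P
      ≤ ∫ ω, (D ω ^ 2 / ε + (ε + 4 * τ * (B + 1 / 2))) ∂P := by
        refine integral_mono_of_nonneg (Eventually.of_forall fun ω => abs_nonneg _)
          (hD2'.add (integrable_const _)) (Eventually.of_forall fun ω => ?_)
        have h1 := abs_eulerInterp_sub_le (P := P) (x₀ := x₀) hB hτ j ω
        have h2 : |D ω| ≤ D ω ^ 2 / ε + ε := by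
          rw [div_add' _ _ _ hε.ne', le_div_iff₀ hε, ← sq_abs (D ω)]
          nlinarith [sq_nonneg (|D ω| - ε), sq_nonneg (|D ω|), sq_nonneg ε]
        have h3 := abs_sub_abs_le_abs_sub
          (eulerSeq P β x₀ τ j ω - eulerSeq P β x₀ (4 * τ) (j / 4) ω) (-D ω)
        have e : eulerSeq P β x₀ τ j ω - eulerSeq P β x₀ (4 * τ) (j / 4) ω - -D ω =
          eulerInterp P β x₀ τ j ω - eulerSeq P β x₀ (4 * τ) (j / 4) ω := by
            simp only [hD]; ring
        rw [e, abs_neg] at h3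
        linarith
    _ = (∫ ω, D ω ^ 2 ∂P) / ε + (ε + 4 * τ * (B + 1 / 2)) := by
        rw [integral_add hD2' (integrable_const _), integral_div]; simp
    _ ≤ _ := by
        have := div_le_div_of_nonneg_right hsq hε.le
        linarith

theorem abs_meanDiff_sub_le {X Y : Ω → ℝ} (hXi : Integrable X P) (hYi : Integrable Y P) {δ : ℝ}
    (hδ : ∀ ω, |X ω - Y ω| ≤ δ) : meanDiff P X ≤ meanDiff P Y + 2 * δ := by
  unfold meanDiff
  have hX := (integrable_sub_prod hXi).abs
  have hY := (integrable_sub_prod hYi).abs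
  have := integral_mono (g := fun q : Ω × Ω => |Y q.1 - Y q.2| + 2 * δ) hX
    (hY.add (integrable_const _)) fun q => by
      have h1 := hδ q.1
      have h2 := hδ q.2
      simp only [abs_le] at h1 h2 ⊢
      have h3 := le_abs_self (Y q.1 - Y q.2)
      have h4 := neg_abs_le (Y q.1 - Y q.2)
      constructor <;> linarith
  rw [integral_add hY (integrable_const _)] at this
  simpa using this

theorem abs_eulerDefect_le (hτ : 0 ≤ τ) (i m : ℕ) (ω : Ω) :
    |eulerDefect P β x₀ τ i m ω| ≤ m * τ := by
  induction m with
  | zero => simp [eulerDefect]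
  | succ m ih =>
    have h1 := abs_midRank_le (P := P) (X := eulerSeq P β x₀ τ (i + m)) ω
    rw [eulerDefect_succ]
    rw [abs_le] at *
    push_cast
    constructor <;> nlinarith

theorem measurable_eulerDefect (hβ : Measurable β) (hx : Measurable x₀) (i m : ℕ) :
    Measurable (eulerDefect P β x₀ τ i m) :=
  (hβ.const_mul _).sub ((measurable_eulerSeq hβ hx _).sub (measurable_eulerSeq hβ hx _))

theorem integral_eulerDefect_succ_mul (hβ : Measurable β) (hx : Measurable x₀) (hτ : 0 ≤ τ)
    (i m : ℕ) {Z : Ω → ℝ} (hZ : Integrable Z P) :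
    ∫ ω, eulerDefect P β x₀ τ i (m + 1) ω * Z ω ∂P =
      ∫ ω, eulerDefect P β x₀ τ i m ω * Z ω ∂P +
        τ * ∫ ω, midRank P (eulerSeq P β x₀ τ (i + m)) ω * Z ω ∂P := by
  simp only [eulerDefect_succ, add_mul, mul_assoc]
  rw [integral_add, integral_const_mul]
  · exact hZ.bdd_mul (c := m * τ) (measurable_eulerDefect hβ hx i m).aestronglyMeasurable
      (Eventually.of_forall fun ω => abs_eulerDefect_le hτ i m ω)
  · exact (integrable_midRank_mul (measurable_eulerSeq hβ hx _) hZ).const_mul τ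

theorem integral_eulerDefect_mul_le (hβ : Measurable β) (hx : Measurable x₀) (hτ : 0 ≤ τ)
    (i m : ℕ) {Z : Ω → ℝ} (hZm : Measurable Z) (hZ : Integrable Z P) :
    ∫ ω, eulerDefect P β x₀ τ i m ω * Z ω ∂P ≤ m * τ * (1 / 4 * meanDiff P Z) := by
  induction m with
  | zero => simp [eulerDefect]
  | succ m ih =>
    rw [integral_eulerDefect_succ_mul hβ hx hτ i m hZ]
    have := isDominated_midRank (P := P)
      (measurable_eulerSeq (P := P) (τ := τ) hβ hx (i + m)) Z hZm hZ
    push_cast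
    nlinarith

theorem le_integral_eulerDefect_mul_self (hβ : Measurable β) (hB : ∀ ω, |β ω| ≤ B)
    (hx : Measurable x₀) (hxi : Integrable x₀ P) (hτ : 0 ≤ τ) (hB0 : 0 ≤ B) (i m : ℕ) :
    m * τ * (1 / 4 * meanDiff P (eulerSeq P β x₀ τ i)) - (B + 1 / 2) * (m * τ) ^ 2 ≤
      ∫ ω, eulerDefect P β x₀ τ i m ω * eulerSeq P β x₀ τ i ω ∂P := by
  induction m with
  | zero => simp [eulerDefect]
  | succ m ih =>
    have hi := integrable_eulerSeq (P := P) (τ := τ) hβ hB hx hxi i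
    have hk := integrable_eulerSeq (P := P) (τ := τ) hβ hB hx hxi (i + m)
    have hkm := measurable_eulerSeq (P := P) (τ := τ) hβ hx (i + m)
    rw [integral_eulerDefect_succ_mul hβ hx hτ i m hi]
    set x := eulerSeq P β x₀ τ with hxdef
    set δ := (B + 1 / 2) * (m * τ) with hδ
    have hd : ∀ ω, |x (i + m) ω - x i ω| ≤ δ := abs_eulerSeq_add_sub_le hB hτ i m
    have h1 : 1 / 4 * meanDiff P (x (i + m)) - 1 / 2 * δ ≤
        ∫ ω, midRank P (x (i + m)) ω * x i ω ∂P := by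
      rw [← integral_midRank_mul_self hkm hk]
      have hI := integrable_midRank_mul hkm hk
      have : ∫ ω, (midRank P (x (i + m)) ω * x (i + m) ω - 1 / 2 * δ) ∂P ≤
          ∫ ω, midRank P (x (i + m)) ω * x i ω ∂P := by
        refine integral_mono (hI.sub (integrable_const _)) (integrable_midRank_mul hkm hi)
          fun ω => ?_
        have h2 : midRank P (x (i + m)) ω * (x (i + m) ω - x i ω) ≤ 1 / 2 * δ := by
          refine (le_abs_self _).trans ?_
          rw [abs_mul]
          exact mul_le_mul (abs_midRank_le ω) (hd ω) (abs_nonneg _) (by norm_num)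
        simp only
        linarith
      rw [integral_sub hI (integrable_const _)] at this
      simpa using this
    have h2 := abs_meanDiff_sub_le (P := P) hi hk (δ := δ) fun ω => by
      rw [abs_sub_comm]; exact hd ω
    have h3 : 1 / 4 * meanDiff P (x i) - δ ≤ ∫ ω, midRank P (x (i + m)) ω * x i ω ∂P := by
      linarith
    have h4 := mul_le_mul_of_nonneg_left h3 hτ
    have h5 : (0:ℝ) ≤ m := m.cast_nonneg
    have h6 : 0 ≤ (B + 1 / 2) * τ ^ 2 * (m + 1) := by positivity
    push_cast
    rw [hδ] at h4
    nlinarith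

end Euler

theorem limsup_le_limsup_add {a b ε : ℕ → ℝ} {c M : ℝ} (hε : Tendsto ε atTop (nhds 0))
    (hab : ∀ n, a n ≤ b n + (c + ε n)) (ha : ∀ n, -M ≤ a n) (hb : ∀ n, b n ≤ M) :
    limsup a atTop ≤ limsup b atTop + c := by
  refine le_of_forall_pos_le_add fun δ hδ => ?_
  have hbb : IsBoundedUnder (· ≤ ·) atTop b := ⟨M, eventually_map.2 (Eventually.of_forall hb)⟩
  have hac : IsCoboundedUnder (· ≤ ·) atTop a :=
    IsBoundedUnder.isCoboundedUnder_le ⟨-M, eventually_map.2 (Eventually.of_forall ha)⟩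
  refine limsup_le_of_le hac ?_
  filter_upwards [eventually_lt_of_limsup_lt (lt_add_of_pos_right (limsup b atTop) (half_pos hδ))
    hbb, hε.eventually (gt_mem_nhds (half_pos hδ))] with n h1 h2
  linarith [hab n]

theorem abs_limsup_sub_le {a b ε : ℕ → ℝ} {c M : ℝ} (hε : Tendsto ε atTop (nhds 0))
    (hab : ∀ n, |a n - b n| ≤ c + ε n) (ha : ∀ n, |a n| ≤ M) (hb : ∀ n, |b n| ≤ M) :
    |limsup a atTop - limsup b atTop| ≤ c := by
  have h1 := limsup_le_limsup_add hε (fun n => by linarith [(abs_le.1 (hab n)).2])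
    (fun n => (abs_le.1 (ha n)).1) (fun n => (abs_le.1 (hb n)).2) (a := a) (b := b) (c := c)
  have h2 := limsup_le_limsup_add hε (fun n => by linarith [(abs_le.1 (hab n)).1])
    (fun n => (abs_le.1 (hb n)).1) (fun n => (abs_le.1 (ha n)).2) (a := b) (b := a) (c := c)
  rw [abs_le]; constructor <;> linarith

theorem ae_exists_tendsto_of_summable_integral {Ω : Type*} [MeasurableSpace Ω] {P : Measure Ω}
    {f : ℕ → Ω → ℝ} (hf : ∀ n, Integrable (f n) P) {c : ℕ → ℝ} (hc : Summable c)
    (h : ∀ n, ∫ ω, |f (n + 1) ω - f n ω| ∂P ≤ c n) :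
    ∀ᵐ ω ∂P, ∃ l, Tendsto (fun n => f n ω) atTop (nhds l) := by
  have hi : ∀ n, Integrable (fun ω => |f (n + 1) ω - f n ω|) P := fun n =>
    ((hf (n + 1)).sub (hf n)).abs
  have hc0 : ∀ n, 0 ≤ c n := fun n => (integral_nonneg fun ω => abs_nonneg _).trans (h n)
  have hm : ∀ n, AEMeasurable (fun ω => ENNReal.ofReal |f (n + 1) ω - f n ω|) P := fun n =>
    (hi n).aestronglyMeasurable.aemeasurable.ennreal_ofReal
  have hfin : ∫⁻ ω, ∑' n, ENNReal.ofReal |f (n + 1) ω - f n ω| ∂P ≠ ⊤ := by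
    rw [lintegral_tsum hm]
    refine ne_top_of_le_ne_top (b := ENNReal.ofReal (∑' n, c n)) ENNReal.ofReal_ne_top ?_
    rw [ENNReal.ofReal_tsum_of_nonneg hc0 hc]
    refine ENNReal.tsum_le_tsum fun n => ?_
    rw [← ofReal_integral_eq_lintegral_ofReal (hi n) (Eventually.of_forall fun ω => abs_nonneg _)]
    exact ENNReal.ofReal_le_ofReal (h n)
  filter_upwards [ae_lt_top' (AEMeasurable.tsum hm) hfin] with ω hω
  have hs : Summable fun n => dist (f n ω) (f n.succ ω) := by
    have := ENNReal.summable_toReal hω.ne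
    refine this.congr fun n => ?_
    rw [ENNReal.toReal_ofReal (abs_nonneg _), dist_comm, Real.dist_eq]
  exact cauchySeq_tendsto_of_complete (cauchySeq_of_summable_dist hs)

section Flow

variable {Ω : Type*} [MeasurableSpace Ω]

/-- Piecewise constant interpolation of the Euler scheme with step `4⁻ⁿ`. -/
noncomputable def eulerFlow (P : Measure Ω) (β x₀ : Ω → ℝ) (n : ℕ) (t : ℝ) : Ω → ℝ :=
  eulerSeq P β x₀ ((1 / 4) ^ n) ⌊t * 4 ^ n⌋₊

/-- The limit of the Euler schemes. -/
noncomputable def limitFlow (P : Measure Ω) (β x₀ : Ω → ℝ) (t : ℝ) (ω : Ω) : ℝ :=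
  limsup (fun n => eulerFlow P β x₀ n t ω) atTop

theorem pow_four_mul (n : ℕ) : (4 : ℝ) ^ n * (1 / 4) ^ n = 1 := by
  rw [← mul_pow]; norm_num

theorem floor_mul_step_le {t : ℝ} (ht : 0 ≤ t) (n : ℕ) : (⌊t * 4 ^ n⌋₊ : ℝ) * (1 / 4) ^ n ≤ t := by
  have h1 := Nat.floor_le (a := t * 4 ^ n) (by positivity)
  have h2 : (0 : ℝ) ≤ (1 / 4) ^ n := by positivity
  calc (⌊t * 4 ^ n⌋₊ : ℝ) * (1 / 4) ^ n ≤ t * 4 ^ n * (1 / 4) ^ n := by gcongr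
    _ = t := by rw [mul_assoc, pow_four_mul, mul_one]

theorem lt_floor_mul_step {t : ℝ} (n : ℕ) :
    t < (⌊t * 4 ^ n⌋₊ : ℝ) * (1 / 4) ^ n + (1 / 4) ^ n := by
  have h1 := Nat.lt_floor_add_one (t * 4 ^ n)
  have h2 : (0 : ℝ) < (1 / 4) ^ n := by positivity
  calc t = t * 4 ^ n * (1 / 4) ^ n := by rw [mul_assoc, pow_four_mul, mul_one]
    _ < (⌊t * 4 ^ n⌋₊ + 1) * (1 / 4) ^ n := by gcongr
    _ = _ := by ring

theorem tendsto_step : Tendsto (fun n : ℕ => ((1 : ℝ) / 4) ^ n) atTop (nhds 0) :=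
  tendsto_pow_atTop_nhds_zero_of_lt_one (by norm_num) (by norm_num)

theorem tendsto_floor_mul_step {t : ℝ} (ht : 0 ≤ t) :
    Tendsto (fun n : ℕ => (⌊t * 4 ^ n⌋₊ : ℝ) * (1 / 4) ^ n) atTop (nhds t) := by
  have h : Tendsto (fun n : ℕ => t - (1 / 4) ^ n) atTop (nhds t) := by
    simpa using tendsto_step.const_sub t
  exact tendsto_of_tendsto_of_tendsto_of_le_of_le h tendsto_const_nhds
    (fun n => by linarith [lt_floor_mul_step (t := t) n]) (fun n => floor_mul_step_le ht n)

theorem abs_eulerFlow_sub_le {P : Measure Ω} [IsProbabilityMeasure P] {β x₀ : Ω → ℝ} {B : ℝ}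
    (hB0 : 0 ≤ B) (hB : ∀ ω, |β ω| ≤ B) (n : ℕ) (s t : ℝ) (ω : Ω) :
    |eulerFlow P β x₀ n t ω - eulerFlow P β x₀ n s ω| ≤
      (B + 1 / 2) * |t - s| + (B + 1 / 2) * (1 / 4) ^ n := by
  wlog hst : s ≤ t generalizing s t
  · rw [abs_sub_comm, abs_sub_comm t]; exact this t s (le_of_not_ge hst)
  have hτ : (0 : ℝ) ≤ (1 / 4) ^ n := by positivity
  obtain ⟨m, hm⟩ := Nat.exists_eq_add_of_le
    (Nat.floor_le_floor (mul_le_mul_of_nonneg_right hst (by positivity : (0 : ℝ) ≤ 4 ^ n)))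
  have h1 := abs_eulerSeq_add_sub_le (P := P) (x₀ := x₀) hB hτ ⌊s * 4 ^ n⌋₊ m ω
  rw [← hm] at h1
  refine h1.trans ?_
  rw [← mul_add]
  gcongr
  rw [abs_of_nonneg (sub_nonneg.2 hst)]
  have h2 := lt_floor_mul_step (t := s) n
  rcases le_or_gt 0 t with ht | ht
  · have h3 := floor_mul_step_le ht n
    rw [hm] at h3
    push_cast at h3
    linarith
  · have h0 : ⌊t * 4 ^ n⌋₊ = 0 := Nat.floor_of_nonpos
      (mul_nonpos_of_nonpos_of_nonneg ht.le (by positivity))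
    have : m = 0 := by omega
    simp only [this, Nat.cast_zero, zero_mul]
    linarith

theorem eulerFlow_zero (P : Measure Ω) (β x₀ : Ω → ℝ) (n : ℕ) : eulerFlow P β x₀ n 0 = x₀ := by
  simp [eulerFlow, eulerSeq]

theorem limitFlow_zero (P : Measure Ω) (β x₀ : Ω → ℝ) : limitFlow P β x₀ 0 = x₀ := by
  ext ω; simp [limitFlow, eulerFlow_zero]

variable {P : Measure Ω} [IsProbabilityMeasure P] {β x₀ : Ω → ℝ} {B : ℝ}

theorem abs_eulerFlow_le (hB0 : 0 ≤ B) (hB : ∀ ω, |β ω| ≤ B) (n : ℕ) (t : ℝ) (ω : Ω) :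
    |eulerFlow P β x₀ n t ω| ≤ |x₀ ω| + (B + 1 / 2) * (|t| + 1) := by
  have h1 := abs_eulerFlow_sub_le (P := P) (x₀ := x₀) hB0 hB n 0 t ω
  rw [eulerFlow_zero, sub_zero] at h1
  have h2 := abs_sub_abs_le_abs_sub (eulerFlow P β x₀ n t ω) (x₀ ω)
  have h3 : ((1 : ℝ) / 4) ^ n ≤ 1 := pow_le_one₀ (by norm_num) (by norm_num)
  nlinarith

theorem abs_limitFlow_sub_le (hB0 : 0 ≤ B) (hB : ∀ ω, |β ω| ≤ B) (s t : ℝ) (ω : Ω) :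
    |limitFlow P β x₀ t ω - limitFlow P β x₀ s ω| ≤ (B + 1 / 2) * |t - s| := by
  refine abs_limsup_sub_le (ε := fun n => (B + 1 / 2) * (1 / 4) ^ n)
    (M := |x₀ ω| + (B + 1 / 2) * (max |t| |s| + 1)) ?_
    (fun n => abs_eulerFlow_sub_le hB0 hB n s t ω)
    (fun n => (abs_eulerFlow_le hB0 hB n t ω).trans ?_)
    (fun n => (abs_eulerFlow_le hB0 hB n s ω).trans ?_)
  · simpa using tendsto_step.const_mul (B + 1 / 2)
  · gcongr; exact le_max_left _ _
  · gcongr; exact le_max_right _ _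

theorem measurable_eulerFlow (hβ : Measurable β) (hx : Measurable x₀) (n : ℕ) (t : ℝ) :
    Measurable (eulerFlow P β x₀ n t) := measurable_eulerSeq hβ hx _

theorem measurable_uncurry_limitFlow (hβ : Measurable β) (hx : Measurable x₀) :
    Measurable fun p : ℝ × Ω => limitFlow P β x₀ p.1 p.2 := by
  refine Measurable.limsup fun n => ?_
  have h : Measurable fun q : ℕ × Ω => eulerSeq P β x₀ ((1 / 4) ^ n) q.1 q.2 :=
    measurable_from_prod_countable_right fun k => measurable_eulerSeq hβ hx k
  exact h.comp ((Nat.measurable_floor.comp (measurable_fst.mul_const _)).prodMk measurable_snd)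

theorem measurable_limitFlow (hβ : Measurable β) (hx : Measurable x₀) (t : ℝ) :
    Measurable (limitFlow P β x₀ t) :=
  Measurable.limsup fun n => measurable_eulerFlow hβ hx n t

theorem integrable_eulerFlow (hβ : Measurable β) (hB : ∀ ω, |β ω| ≤ B) (hx : Measurable x₀)
    (hxi : Integrable x₀ P) (n : ℕ) (t : ℝ) : Integrable (eulerFlow P β x₀ n t) P :=
  integrable_eulerSeq hβ hB hx hxi _

theorem integral_abs_eulerFlow_succ_sub_le (hβ : Measurable β) (hB0 : 0 ≤ B)
    (hB : ∀ ω, |β ω| ≤ B) (hx : Measurable x₀) (hxi : Integrable x₀ P) {t : ℝ} (ht : 0 ≤ t)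
    (n : ℕ) : ∫ ω, |eulerFlow P β x₀ (n + 1) t ω - eulerFlow P β x₀ n t ω| ∂P ≤
      (t * (8 * B + 5) + 1 + 4 * (B + 1 / 2)) * (1 / 2) ^ (n + 1) := by
  have e1 : (4 : ℝ) * (1 / 4) ^ (n + 1) = (1 / 4) ^ n := by rw [pow_succ]; ring
  have e2 : ⌊t * 4 ^ n⌋₊ = ⌊t * 4 ^ (n + 1)⌋₊ / 4 := by
    rw [← Nat.floor_div_ofNat]; congr 1; rw [pow_succ]; ring
  have hτ : (0 : ℝ) ≤ (1 / 4) ^ (n + 1) := by positivity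
  have h := integral_abs_eulerSeq_refine_le hβ hB hx hxi hτ ⌊t * 4 ^ (n + 1)⌋₊
    (ε := (1 / 2) ^ (n + 1)) (by positivity)
  rw [e1, ← e2] at h
  refine h.trans ?_
  have h1 := floor_mul_step_le ht (n + 1)
  have e3 : ((1 : ℝ) / 4) ^ (n + 1) = (1 / 2) ^ (n + 1) * (1 / 2) ^ (n + 1) := by
    rw [← mul_pow]; norm_num
  have h2 : ((1 : ℝ) / 2) ^ (n + 1) ≤ 1 := pow_le_one₀ (by norm_num) (by norm_num)
  set u : ℝ := (1 / 2) ^ (n + 1) with hu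
  have hu0 : 0 < u := by positivity
  rw [← e1, e3]
  rw [e3] at h1
  have e4 : (⌊t * 4 ^ (n + 1)⌋₊ : ℝ) * ((u * u) ^ 2 * (8 * B + 5)) / u =
      (⌊t * 4 ^ (n + 1)⌋₊ * (u * u)) * (8 * B + 5) * u := by
    field_simp
  rw [e4]
  have h3 : (⌊t * 4 ^ (n + 1)⌋₊ * (u * u)) * (8 * B + 5) * u ≤ t * (8 * B + 5) * u := by gcongr
  have h4 : 4 * (u * u) * (B + 1 / 2) ≤ 4 * (B + 1 / 2) * u := by
    have : u * u ≤ u := by nlinarith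
    nlinarith
  linarith

theorem ae_tendsto_eulerFlow (hβ : Measurable β) (hB0 : 0 ≤ B) (hB : ∀ ω, |β ω| ≤ B)
    (hx : Measurable x₀) (hxi : Integrable x₀ P) {t : ℝ} (ht : 0 ≤ t) :
    ∀ᵐ ω ∂P, Tendsto (fun n => eulerFlow P β x₀ n t ω) atTop (nhds (limitFlow P β x₀ t ω)) := by
  have hs : Summable fun n : ℕ =>
      (t * (8 * B + 5) + 1 + 4 * (B + 1 / 2)) * ((1 : ℝ) / 2) ^ (n + 1) :=
    Summable.mul_left _ ((summable_nat_add_iff 1).2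
      (summable_geometric_of_lt_one (by norm_num) (by norm_num)))
  filter_upwards [ae_exists_tendsto_of_summable_integral
    (fun n => integrable_eulerFlow hβ hB hx hxi n t) hs
    (fun n => integral_abs_eulerFlow_succ_sub_le hβ hB0 hB hx hxi ht n)] with ω ⟨l, hl⟩
  rw [limitFlow, hl.limsup_eq]
  exact hl

theorem tendsto_meanDiff {F : ℕ → Ω → ℝ} {f bound : Ω → ℝ}
    (hF : ∀ n, AEStronglyMeasurable (F n) P) (hb : Integrable bound P)
    (hFb : ∀ n, ∀ᵐ ω ∂P, |F n ω| ≤ bound ω)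
    (hlim : ∀ᵐ ω ∂P, Tendsto (fun n => F n ω) atTop (nhds (f ω))) :
    Tendsto (fun n => meanDiff P (F n)) atTop (nhds (meanDiff P f)) := by
  have hq1 : Measure.QuasiMeasurePreserving (Prod.fst : Ω × Ω → Ω) (P.prod P) P :=
    Measure.quasiMeasurePreserving_fst
  have hq2 : Measure.QuasiMeasurePreserving (Prod.snd : Ω × Ω → Ω) (P.prod P) P :=
    Measure.quasiMeasurePreserving_snd
  refine tendsto_integral_of_dominated_convergence (fun q => bound q.1 + bound q.2) (fun n => ?_)
    ((hb.comp_fst P).add (hb.comp_snd P)) (fun n => ?_) ?_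
  · exact (((hF n).comp_quasiMeasurePreserving hq1).sub
      ((hF n).comp_quasiMeasurePreserving hq2)).norm
  · filter_upwards [hq1.ae (hFb n), hq2.ae (hFb n)] with q h1 h2
    rw [Real.norm_eq_abs, abs_abs]
    exact (abs_sub _ _).trans (add_le_add h1 h2)
  · filter_upwards [hq1.ae hlim, hq2.ae hlim] with q h1 h2
    exact (h1.sub h2).abs

theorem integrable_limitFlow (hβ : Measurable β) (hB0 : 0 ≤ B) (hB : ∀ ω, |β ω| ≤ B)
    (hx : Measurable x₀) (hxi : Integrable x₀ P) (t : ℝ) :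
    Integrable (limitFlow P β x₀ t) P := by
  refine (hxi.abs.add (integrable_const ((B + 1 / 2) * |t|))).mono'
    (measurable_limitFlow hβ hx t).aestronglyMeasurable (Eventually.of_forall fun ω => ?_)
  have h := abs_limitFlow_sub_le (P := P) (x₀ := x₀) hB0 hB 0 t ω
  rw [limitFlow_zero, sub_zero] at h
  have := abs_sub_abs_le_abs_sub (limitFlow P β x₀ t ω) (x₀ ω)
  rw [Real.norm_eq_abs, Pi.add_apply]
  linarith

/-- The subgradient relations satisfied by the time averages of the limit flow. -/
theorem limitFlow_average (hβ : Measurable β) (hB0 : 0 ≤ B) (hB : ∀ ω, |β ω| ≤ B)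
    (hx : Measurable x₀) (hxi : Integrable x₀ P) {t s : ℝ} (ht : 0 ≤ t) (hs : 0 ≤ s) :
    (∀ Z : Ω → ℝ, Measurable Z → Integrable Z P →
      ∫ ω, (s * β ω - (limitFlow P β x₀ (t + s) ω - limitFlow P β x₀ t ω)) * Z ω ∂P ≤
        s * (1 / 4 * meanDiff P Z)) ∧
    s * (1 / 4 * meanDiff P (limitFlow P β x₀ t)) - (B + 1 / 2) * s ^ 2 ≤
      ∫ ω, (s * β ω - (limitFlow P β x₀ (t + s) ω - limitFlow P β x₀ t ω)) *
        limitFlow P β x₀ t ω ∂P := by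
  have hts : 0 ≤ t + s := add_nonneg ht hs
  set i : ℕ → ℕ := fun n => ⌊t * 4 ^ n⌋₊ with hi
  set m : ℕ → ℕ := fun n => ⌊(t + s) * 4 ^ n⌋₊ - ⌊t * 4 ^ n⌋₊ with hm
  have him : ∀ n, i n + m n = ⌊(t + s) * 4 ^ n⌋₊ := fun n => Nat.add_sub_cancel'
    (Nat.floor_le_floor (mul_le_mul_of_nonneg_right (by linarith) (by positivity)))
  have hτ : ∀ n : ℕ, (0 : ℝ) ≤ (1 / 4) ^ n := fun n => by positivity
  have hmτ : Tendsto (fun n => (m n : ℝ) * (1 / 4) ^ n) atTop (nhds s) := by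
    have h := (tendsto_floor_mul_step hts).sub (tendsto_floor_mul_step ht)
    rw [add_sub_cancel_left] at h
    refine h.congr fun n => ?_
    rw [← him n]; push_cast; ring
  have hmb : ∀ n, (m n : ℝ) * (1 / 4) ^ n ≤ t + s := fun n => by
    refine le_trans ?_ (floor_mul_step_le hts n)
    have := hτ n
    gcongr
    exact Nat.sub_le _ _
  set D : ℕ → Ω → ℝ := fun n => eulerDefect P β x₀ ((1 / 4) ^ n) (i n) (m n) with hD
  have hDe : ∀ n ω, D n ω = m n * (1 / 4) ^ n * β ω -
      (eulerFlow P β x₀ n (t + s) ω - eulerFlow P β x₀ n t ω) := fun n ω => by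
    simp only [hD, eulerDefect, eulerFlow, ← him n]
    rfl
  have hDb : ∀ n ω, |D n ω| ≤ t + s := fun n ω =>
    (abs_eulerDefect_le (hτ n) _ _ ω).trans (hmb n)
  have hDm : ∀ n, Measurable (D n) := fun n => measurable_eulerDefect hβ hx _ _
  have hDlim : ∀ᵐ ω ∂P, Tendsto (fun n => D n ω) atTop
      (nhds (s * β ω - (limitFlow P β x₀ (t + s) ω - limitFlow P β x₀ t ω))) := by
    filter_upwards [ae_tendsto_eulerFlow hβ hB0 hB hx hxi ht,
      ae_tendsto_eulerFlow hβ hB0 hB hx hxi hts] with ω h1 h2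
    simp only [hDe]
    exact (hmτ.mul_const _).sub (h2.sub h1)
  constructor
  · intro Z hZm hZ
    have hlim : Tendsto (fun n => ∫ ω, D n ω * Z ω ∂P) atTop (nhds (∫ ω,
        (s * β ω - (limitFlow P β x₀ (t + s) ω - limitFlow P β x₀ t ω)) * Z ω ∂P)) := by
      refine tendsto_integral_of_dominated_convergence (fun ω => (t + s) * |Z ω|)
        (fun n => ((hDm n).mul hZm).aestronglyMeasurable) (hZ.abs.const_mul _)
        (fun n => Eventually.of_forall fun ω => ?_) ?_
      · rw [Real.norm_eq_abs, abs_mul]; gcongr; exact hDb n ω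
      · filter_upwards [hDlim] with ω h
        exact h.mul_const _
    exact le_of_tendsto_of_tendsto' hlim (hmτ.mul_const _) fun n =>
      integral_eulerDefect_mul_le hβ hx (hτ n) _ _ hZm hZ
  · have hEb : ∀ n ω, |eulerFlow P β x₀ n t ω| ≤ |x₀ ω| + (B + 1 / 2) * (|t| + 1) :=
      fun n ω => abs_eulerFlow_le hB0 hB n t ω
    have hbi : Integrable (fun ω => |x₀ ω| + (B + 1 / 2) * (|t| + 1)) P :=
      hxi.abs.add (integrable_const _)
    have hlim : Tendsto (fun n => ∫ ω, D n ω * eulerFlow P β x₀ n t ω ∂P) atTop (nhds (∫ ω,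
        (s * β ω - (limitFlow P β x₀ (t + s) ω - limitFlow P β x₀ t ω)) *
          limitFlow P β x₀ t ω ∂P)) := by
      refine tendsto_integral_of_dominated_convergence
        (fun ω => (t + s) * (|x₀ ω| + (B + 1 / 2) * (|t| + 1)))
        (fun n => ((hDm n).mul (measurable_eulerFlow hβ hx n t)).aestronglyMeasurable)
        (hbi.const_mul _) (fun n => Eventually.of_forall fun ω => ?_) ?_
      · rw [Real.norm_eq_abs, abs_mul]
        exact mul_le_mul (hDb n ω) (hEb n ω) (abs_nonneg _) hts
      · filter_upwards [hDlim, ae_tendsto_eulerFlow hβ hB0 hB hx hxi ht] with ω h1 h2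
        exact h1.mul h2
    have hmd := tendsto_meanDiff (P := P)
      (fun n => (measurable_eulerFlow (P := P) hβ hx n t).aestronglyMeasurable) hbi
      (fun n => Eventually.of_forall (hEb n)) (ae_tendsto_eulerFlow hβ hB0 hB hx hxi ht)
    exact le_of_tendsto_of_tendsto'
      ((hmτ.mul (hmd.const_mul (1 / 4))).sub ((hmτ.pow 2).const_mul (B + 1 / 2))) hlim fun n =>
      le_integral_eulerDefect_mul_self hβ hB hx hxi (hτ n) hB0 _ _

end Flow

section Velocity

variable {Ω : Type*}

/-- Forward difference quotient with step `1 / (m + 1)`. -/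
noncomputable def forwardQuotient (X : ℝ → Ω → ℝ) (m : ℕ) (t : ℝ) (ω : Ω) : ℝ :=
  ((m : ℝ) + 1) * (X (t + 1 / ((m : ℝ) + 1)) ω - X t ω)

/-- The upper right velocity of a family of trajectories. -/
noncomputable def flowVelocity (X : ℝ → Ω → ℝ) (t : ℝ) (ω : Ω) : ℝ :=
  limsup (fun m => forwardQuotient X m t ω) atTop

variable {X : ℝ → Ω → ℝ} {C : ℝ}

theorem abs_forwardQuotient_le (hL : ∀ s t ω, |X t ω - X s ω| ≤ C * |t - s|) (m : ℕ) (t : ℝ)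
    (ω : Ω) : |forwardQuotient X m t ω| ≤ C := by
  have hm : (0 : ℝ) < (m : ℝ) + 1 := by positivity
  have h := hL t (t + 1 / ((m : ℝ) + 1)) ω
  rw [add_sub_cancel_left, abs_of_pos (by positivity : (0 : ℝ) < 1 / ((m : ℝ) + 1))] at h
  rw [forwardQuotient, abs_mul, abs_of_pos hm]
  calc ((m : ℝ) + 1) * |X (t + 1 / ((m : ℝ) + 1)) ω - X t ω|
      ≤ ((m : ℝ) + 1) * (C * (1 / ((m : ℝ) + 1))) := by gcongr
    _ = C := by field_simp

theorem abs_flowVelocity_le (hL : ∀ s t ω, |X t ω - X s ω| ≤ C * |t - s|) (t : ℝ) (ω : Ω) :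
    |flowVelocity X t ω| ≤ C := by
  have hC : 0 ≤ C := (abs_nonneg _).trans (abs_forwardQuotient_le hL 0 t ω)
  have h := abs_limsup_sub_le (a := fun m => forwardQuotient X m t ω) (b := fun _ => 0)
    (ε := fun _ => 0) (c := C) (M := C) tendsto_const_nhds
    (fun m => by simpa using abs_forwardQuotient_le hL m t ω)
    (fun m => abs_forwardQuotient_le hL m t ω) (fun _ => by simpa using hC)
  simpa [flowVelocity] using h

theorem tendsto_forwardQuotient {t d : ℝ} {ω : Ω} (h : HasDerivAt (fun s => X s ω) d t) :
    Tendsto (fun m => forwardQuotient X m t ω) atTop (nhds d) := by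
  have h1 : Tendsto (fun m : ℕ => 1 / ((m : ℝ) + 1)) atTop (nhdsWithin 0 {0}ᶜ) :=
    tendsto_nhdsWithin_iff.2 ⟨tendsto_one_div_add_atTop_nhds_zero_nat,
      Eventually.of_forall fun m => by
        have : (0 : ℝ) < 1 / ((m : ℝ) + 1) := by positivity
        exact this.ne'⟩
  refine (h.tendsto_slope_zero.comp h1).congr fun m => ?_
  simp [forwardQuotient]

theorem ae_hasDerivAt_flowVelocity (hC : 0 ≤ C) (hL : ∀ s t ω, |X t ω - X s ω| ≤ C * |t - s|)
    (ω : Ω) : ∀ᵐ t, HasDerivAt (fun s => X s ω) (flowVelocity X t ω) t := by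
  have hlip : LipschitzWith C.toNNReal (fun s => X s ω) :=
    LipschitzWith.of_dist_le_mul fun s t => by
      rw [Real.dist_eq, Real.dist_eq, Real.coe_toNNReal _ hC]; exact hL t s ω
  filter_upwards [hlip.ae_differentiableAt_real] with t ht
  have h := ht.hasDerivAt
  rwa [← (tendsto_forwardQuotient h).limsup_eq] at h

variable [MeasurableSpace Ω]

theorem measurable_uncurry_forwardQuotient (hX : Measurable fun p : ℝ × Ω => X p.1 p.2) (m : ℕ) :
    Measurable fun p : ℝ × Ω => forwardQuotient X m p.1 p.2 := by
  have h : Measurable fun p : ℝ × Ω => X (p.1 + 1 / ((m : ℝ) + 1)) p.2 :=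
    hX.comp ((measurable_fst.add_const _).prodMk measurable_snd)
  exact (h.sub hX).const_mul _

theorem measurable_uncurry_flowVelocity (hX : Measurable fun p : ℝ × Ω => X p.1 p.2) :
    Measurable fun p : ℝ × Ω => flowVelocity X p.1 p.2 :=
  Measurable.limsup fun m => measurable_uncurry_forwardQuotient hX m

theorem ae_ae_tendsto_forwardQuotient (hX : Measurable fun p : ℝ × Ω => X p.1 p.2) (hC : 0 ≤ C)
    (hL : ∀ s t ω, |X t ω - X s ω| ≤ C * |t - s|) (P : Measure Ω) [SFinite P] :
    ∀ᵐ t : ℝ, ∀ᵐ ω ∂P, Tendsto (fun m => forwardQuotient X m t ω) atTop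
      (nhds (flowVelocity X t ω)) := by
  have hS : MeasurableSet {p : ℝ × Ω | ∃ l, Tendsto (fun m => forwardQuotient X m p.1 p.2) atTop
      (nhds l)} :=
    measurableSet_exists_tendsto fun m => measurable_uncurry_forwardQuotient hX m
  have h := (Measure.ae_ae_comm (μ := (volume : Measure ℝ)) (ν := P)
    (p := fun t ω => ∃ l, Tendsto (fun m => forwardQuotient X m t ω) atTop (nhds l)) hS).2
    (Eventually.of_forall fun ω => by
      filter_upwards [ae_hasDerivAt_flowVelocity hC hL ω] with t ht
      exact ⟨_, tendsto_forwardQuotient ht⟩)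
  filter_upwards [h] with t ht
  filter_upwards [ht] with ω ⟨l, hl⟩
  rwa [flowVelocity, hl.limsup_eq]

end Velocity

section Subgradient

variable {Ω : Type*} [MeasurableSpace Ω] {P : Measure Ω} [IsProbabilityMeasure P]
  {β x₀ : Ω → ℝ} {B : ℝ}

/-- At almost every time, `β - V` is a subgradient of `meanDiff / 4` at the limit flow. -/
theorem ae_subgradient_limitFlow (hβ : Measurable β) (hB0 : 0 ≤ B) (hB : ∀ ω, |β ω| ≤ B)
    (hx : Measurable x₀) (hxi : Integrable x₀ P) :
    ∀ᵐ t : ℝ, 0 ≤ t → IsDominated P (fun ω => β ω - flowVelocity (limitFlow P β x₀) t ω) ∧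
      1 / 4 * meanDiff P (limitFlow P β x₀ t) ≤
        ∫ ω, (β ω - flowVelocity (limitFlow P β x₀) t ω) * limitFlow P β x₀ t ω ∂P := by
  have hXm := measurable_uncurry_limitFlow (P := P) hβ hx
  have hL := abs_limitFlow_sub_le (P := P) (x₀ := x₀) hB0 hB
  have hC : 0 ≤ B + 1 / 2 := by positivity
  filter_upwards [ae_ae_tendsto_forwardQuotient hXm hC hL P] with t hlim ht
  set X := limitFlow P β x₀ with hXdef
  have hq : ∀ (m : ℕ) ω, ((m : ℝ) + 1) * (1 / ((m : ℝ) + 1) * β ω -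
      (X (t + 1 / ((m : ℝ) + 1)) ω - X t ω)) = β ω - forwardQuotient X m t ω := by
    intro m ω
    have hm : (0 : ℝ) < (m : ℝ) + 1 := by positivity
    rw [forwardQuotient]; field_simp
  have hlimZ : ∀ Z : Ω → ℝ, Measurable Z → Integrable Z P →
      Tendsto (fun m : ℕ => ((m : ℝ) + 1) * ∫ ω, (1 / ((m : ℝ) + 1) * β ω -
        (X (t + 1 / ((m : ℝ) + 1)) ω - X t ω)) * Z ω ∂P) atTop
        (nhds (∫ ω, (β ω - flowVelocity X t ω) * Z ω ∂P)) := by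
    intro Z hZm hZ
    have e : ∀ m : ℕ, ((m : ℝ) + 1) * ∫ ω, (1 / ((m : ℝ) + 1) * β ω -
        (X (t + 1 / ((m : ℝ) + 1)) ω - X t ω)) * Z ω ∂P =
        ∫ ω, (β ω - forwardQuotient X m t ω) * Z ω ∂P := fun m => by
      rw [← integral_const_mul]
      refine integral_congr_ae (Eventually.of_forall fun ω => ?_)
      simp only [← mul_assoc, hq]
    simp only [e]
    refine tendsto_integral_of_dominated_convergence (fun ω => (B + (B + 1 / 2)) * |Z ω|)
      (fun m => ((hβ.sub ((measurable_uncurry_forwardQuotient hXm m).comp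
        (measurable_prodMk_left (x := t)))).mul hZm).aestronglyMeasurable)
      (hZ.abs.const_mul _) (fun m => Eventually.of_forall fun ω => ?_) ?_
    · rw [Real.norm_eq_abs, abs_mul]
      gcongr
      exact (abs_sub _ _).trans (add_le_add (hB ω) (abs_forwardQuotient_le hL m t ω))
    · filter_upwards [hlim] with ω h
      exact (h.const_sub _).mul_const _
  constructor
  · intro Z hZm hZ
    refine le_of_tendsto' (hlimZ Z hZm hZ) fun m => ?_
    have hm : (0 : ℝ) < (m : ℝ) + 1 := by positivity
    have h := (limitFlow_average (P := P) hβ hB0 hB hx hxi ht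
      (s := 1 / ((m : ℝ) + 1)) (by positivity)).1 Z hZm hZ
    calc _ ≤ ((m : ℝ) + 1) * (1 / ((m : ℝ) + 1) * (1 / 4 * meanDiff P Z)) := by gcongr
      _ = _ := by field_simp
  · have hX := measurable_limitFlow (P := P) hβ hx t
    have hXi := integrable_limitFlow (P := P) hβ hB0 hB hx hxi t
    have hlow : Tendsto (fun m : ℕ => 1 / 4 * meanDiff P (X t) -
        (B + 1 / 2) * (1 / ((m : ℝ) + 1))) atTop (nhds (1 / 4 * meanDiff P (X t))) := by
      simpa using (tendsto_one_div_add_atTop_nhds_zero_nat.const_mul (B + 1 / 2)).const_sub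
        (1 / 4 * meanDiff P (X t))
    refine le_of_tendsto_of_tendsto' hlow (hlimZ _ hX hXi) fun m => ?_
    have hm : (0 : ℝ) < (m : ℝ) + 1 := by positivity
    have h := (limitFlow_average (P := P) hβ hB0 hB hx hxi ht
      (s := 1 / ((m : ℝ) + 1)) (by positivity)).2
    calc _ = ((m : ℝ) + 1) * (1 / ((m : ℝ) + 1) * (1 / 4 * meanDiff P (X t)) -
          (B + 1 / 2) * (1 / ((m : ℝ) + 1)) ^ 2) := by field_simp
      _ ≤ _ := by gcongr

end Subgradient

theorem tendsto_mul_abs_add_div_sub_abs (u w : ℝ) :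
    Tendsto (fun m : ℕ => ((m : ℝ) + 1) * (|u + 1 / ((m : ℝ) + 1) * w| - |u|)) atTop
      (nhds (if u < 0 then -w else if u = 0 then |w| else w)) := by
  have h0 : Tendsto (fun m : ℕ => u + 1 / ((m : ℝ) + 1) * w) atTop (nhds u) := by
    simpa using (tendsto_one_div_add_atTop_nhds_zero_nat.mul_const w).const_add u
  refine tendsto_const_nhds.congr' ?_
  rcases lt_trichotomy u 0 with h | h | h
  · filter_upwards [h0.eventually (gt_mem_nhds h)] with m hm
    have : (0 : ℝ) < (m : ℝ) + 1 := by positivity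
    rw [if_pos h, abs_of_neg hm, abs_of_neg h]; field_simp; ring
  · refine Eventually.of_forall fun m => ?_
    have : (0 : ℝ) < (m : ℝ) + 1 := by positivity
    subst h
    simp only [lt_irrefl, if_false, if_true, zero_add, abs_zero, sub_zero]
    rw [abs_mul, abs_of_pos (by positivity : (0 : ℝ) < 1 / ((m : ℝ) + 1))]; field_simp
  · filter_upwards [h0.eventually (lt_mem_nhds h)] with m hm
    have : (0 : ℝ) < (m : ℝ) + 1 := by positivity
    rw [if_neg h.not_gt, if_neg h.ne', abs_of_pos hm, abs_of_pos h]; field_simp; ring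

section Interval

variable {Ω : Type*} [MeasurableSpace Ω] {P : Measure Ω} [IsProbabilityMeasure P]
  {X g : Ω → ℝ}

theorem integral_mul_le_of_isDominated (hX : Measurable X) (hXi : Integrable X P)
    (hgX : 1 / 4 * meanDiff P X ≤ ∫ ω, g ω * X ω ∂P) (hg : Integrable g P)
    (hgXi : Integrable (fun ω => g ω * X ω) P) (hd : IsDominated P g)
    {S : Set Ω} (hS : MeasurableSet S) :
    ∫ ω in S, g ω ∂P ≤ ∫ ω in S, (P.real {ω' | X ω' ≤ X ω} - 1 / 2) ∂P := by
  classical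
  set φ : Ω → ℝ := S.indicator 1 with hφ
  have hφm : Measurable φ := measurable_one.indicator hS
  have hφ0 : ∀ ω, 0 ≤ φ ω := fun ω => Set.indicator_nonneg (fun _ _ => zero_le_one) ω
  have hφ1 : ∀ ω, φ ω ≤ 1 := fun ω => Set.indicator_le_self' (fun _ _ => zero_le_one) ω
  have hφb : ∀ ω, ‖φ ω‖ ≤ 1 := fun ω => by
    rw [Real.norm_eq_abs, abs_of_nonneg (hφ0 ω)]; exact hφ1 ω
  have hφi : Integrable φ P := Integrable.of_bound hφm.aestronglyMeasurable 1
    (Eventually.of_forall hφb)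
  have hgφ : Integrable (fun ω => g ω * φ ω) P :=
    hg.mul_bdd (c := 1) hφm.aestronglyMeasurable (Eventually.of_forall hφb)
  set κ : Ω × Ω → ℝ := fun q => if X q.1 < X q.2 then -1 else 1 with hκ
  have hκm : Measurable κ := Measurable.ite
    (measurableSet_lt (hX.comp measurable_fst) (hX.comp measurable_snd))
    measurable_const measurable_const
  have hκφ : Integrable (fun q => κ q * φ q.1) (P.prod P) :=
    (hφi.comp_fst P).bdd_mul (c := 1) hκm.aestronglyMeasurable (Eventually.of_forall fun q => by
      simp only [hκ]; split_ifs <;> simp)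
  have hκφ' : Integrable (fun q => κ q.swap * φ q.2) (P.prod P) := hκφ.swap
  have hXXm : Measurable fun q : Ω × Ω => X q.1 - X q.2 :=
    (hX.comp measurable_fst).sub (hX.comp measurable_snd)
  have hφφm : Measurable fun q : Ω × Ω => φ q.1 - φ q.2 :=
    (hφm.comp measurable_fst).sub (hφm.comp measurable_snd)
  have hlim : Tendsto (fun m : ℕ => ((m : ℝ) + 1) *
      (meanDiff P (fun ω => X ω + 1 / ((m : ℝ) + 1) * φ ω) - meanDiff P X)) atTop
      (nhds (∫ q, (if X q.1 - X q.2 < 0 then -(φ q.1 - φ q.2) else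
        if X q.1 - X q.2 = 0 then |φ q.1 - φ q.2| else φ q.1 - φ q.2) ∂(P.prod P))) := by
    have e : ∀ m : ℕ, ((m : ℝ) + 1) *
        (meanDiff P (fun ω => X ω + 1 / ((m : ℝ) + 1) * φ ω) - meanDiff P X) =
        ∫ q, ((m : ℝ) + 1) * (|(X q.1 - X q.2) + 1 / ((m : ℝ) + 1) * (φ q.1 - φ q.2)| -
          |X q.1 - X q.2|) ∂(P.prod P) := fun m => by
      have hZ : Integrable (fun ω => X ω + 1 / ((m : ℝ) + 1) * φ ω) P :=
        hXi.add (hφi.const_mul _)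
      rw [integral_const_mul, meanDiff, meanDiff, ← integral_sub
        (integrable_sub_prod hZ).abs (integrable_sub_prod hXi).abs]
      congr 2 with q
      congr 2
      ring
    simp only [e]
    refine tendsto_integral_of_dominated_convergence (fun q => |φ q.1 - φ q.2|) (fun m => ?_)
      (integrable_sub_prod hφi).abs (fun m => Eventually.of_forall fun q => ?_)
      (Eventually.of_forall fun q => tendsto_mul_abs_add_div_sub_abs _ _)
    · exact (((hXXm.add (hφφm.const_mul _)).abs.sub hXXm.abs).const_mul _).aestronglyMeasurable
    · have hm : (0 : ℝ) < (m : ℝ) + 1 := by positivity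
      rw [Real.norm_eq_abs, abs_mul, abs_of_pos hm]
      calc _ ≤ ((m : ℝ) + 1) * |1 / ((m : ℝ) + 1) * (φ q.1 - φ q.2)| := by
            refine mul_le_mul_of_nonneg_left ?_ hm.le
            refine (abs_abs_sub_abs_le_abs_sub _ _).trans (le_of_eq ?_)
            congr 1; ring
        _ = _ := by
            rw [abs_mul, abs_of_pos (by positivity : (0 : ℝ) < 1 / ((m : ℝ) + 1))]; field_simp
  have h1 : ∫ ω, g ω * φ ω ∂P ≤ 1 / 4 * ∫ q, (if X q.1 - X q.2 < 0 then -(φ q.1 - φ q.2) else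
      if X q.1 - X q.2 = 0 then |φ q.1 - φ q.2| else φ q.1 - φ q.2) ∂(P.prod P) := by
    refine ge_of_tendsto' (hlim.const_mul (1 / 4)) fun m => ?_
    have hm : (0 : ℝ) < (m : ℝ) + 1 := by positivity
    have h := hd (fun ω => X ω + 1 / ((m : ℝ) + 1) * φ ω) (hX.add (hφm.const_mul _))
      (hXi.add (hφi.const_mul _))
    have e : ∫ ω, g ω * (X ω + 1 / ((m : ℝ) + 1) * φ ω) ∂P =
        ∫ ω, g ω * X ω ∂P + 1 / ((m : ℝ) + 1) * ∫ ω, g ω * φ ω ∂P := by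
      rw [← integral_const_mul, ← integral_add hgXi (hgφ.const_mul _)]
      congr 1 with ω; ring
    rw [e] at h
    have h2 : 1 / ((m : ℝ) + 1) * ∫ ω, g ω * φ ω ∂P ≤
        1 / 4 * (meanDiff P (fun ω => X ω + 1 / ((m : ℝ) + 1) * φ ω) - meanDiff P X) := by
      linarith
    calc ∫ ω, g ω * φ ω ∂P = ((m : ℝ) + 1) * (1 / ((m : ℝ) + 1) * ∫ ω, g ω * φ ω ∂P) := by
          field_simp
      _ ≤ ((m : ℝ) + 1) * (1 / 4 *
          (meanDiff P (fun ω => X ω + 1 / ((m : ℝ) + 1) * φ ω) - meanDiff P X)) := by gcongr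
      _ = _ := by ring
  have h2 : ∫ q, (if X q.1 - X q.2 < 0 then -(φ q.1 - φ q.2) else
      if X q.1 - X q.2 = 0 then |φ q.1 - φ q.2| else φ q.1 - φ q.2) ∂(P.prod P) ≤
      ∫ q, (κ q * φ q.1 + κ q.swap * φ q.2) ∂(P.prod P) := by
    refine integral_mono ?_ (hκφ.add hκφ') fun q => ?_
    · refine (integrable_sub_prod hφi).mono (Measurable.aestronglyMeasurable ?_) ?_
      · exact Measurable.ite (measurableSet_lt hXXm measurable_const) hφφm.neg
          (Measurable.ite (hXXm (measurableSet_singleton 0)) hφφm.abs hφφm)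
      · refine Eventually.of_forall fun q => ?_
        split_ifs <;> simp [abs_sub_comm (φ q.2)]
    · have h0 := hφ0 q.1
      have h0' := hφ0 q.2
      simp only [hκ, Prod.fst_swap, Prod.snd_swap]
      rcases lt_trichotomy (X q.1) (X q.2) with h | h | h
      · simp only [sub_neg.2 h, h, h.not_gt, if_true, if_false]; linarith
      · simp only [h, sub_self, lt_irrefl, if_true, if_false]
        exact (abs_sub _ _).trans (by rw [abs_of_nonneg h0, abs_of_nonneg h0']; linarith)
      · simp only [sub_neg, h, h.not_gt, if_true, if_false, (sub_pos.2 h).ne']; linarith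
  have h3 : ∫ q, (κ q * φ q.1 + κ q.swap * φ q.2) ∂(P.prod P) =
      2 * ∫ q, κ q * φ q.1 ∂(P.prod P) := by
    rw [integral_add hκφ hκφ', two_mul]
    congr 1
    exact integral_prod_swap (μ := P) (ν := P) fun q => κ q * φ q.1
  have h4 : ∫ q, κ q * φ q.1 ∂(P.prod P) =
      2 * ∫ ω in S, (P.real {ω' | X ω' ≤ X ω} - 1 / 2) ∂P := by
    rw [integral_prod _ hκφ, ← integral_const_mul, ← integral_indicator hS]
    congr 1 with ω
    change ∫ ω', κ (ω, ω') * φ ω ∂P = _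
    rw [integral_mul_const]
    have hle : MeasurableSet {ω' | X ω' ≤ X ω} := measurableSet_le hX measurable_const
    have e : ∫ ω', κ (ω, ω') ∂P = 2 * (P.real {ω' | X ω' ≤ X ω} - 1 / 2) := by
      have : ∀ ω', κ (ω, ω') = 2 * {ω' | X ω' ≤ X ω}.indicator 1 ω' - 1 := fun ω' => by
        by_cases h : X ω < X ω'
        · simp [hκ, h, h.not_ge, Set.indicator]
        · simp only [hκ, h, if_false, Set.indicator, Set.mem_ofPred_eq, not_lt.1 h, if_true,
            Pi.one_apply]; norm_num
      simp only [this]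
      rw [integral_sub
          (((integrable_indicator_iff hle).2 (integrable_const _).integrableOn).const_mul _)
          (integrable_const _),
        integral_const_mul, integral_indicator_one hle]
      simp; ring
    by_cases hω : ω ∈ S
    · simp [hφ, hω, e]
    · simp [hφ, hω]
  have h5 : ∫ ω, g ω * φ ω ∂P = ∫ ω in S, g ω ∂P := by
    rw [← integral_indicator hS]
    congr 1 with ω
    by_cases hω : ω ∈ S <;> simp [hφ, hω]
  rw [h5] at h1
  linarith

theorem ae_le_cdf_of_isDominated (hX : Measurable X) (hXi : Integrable X P)
    (hgX : 1 / 4 * meanDiff P X ≤ ∫ ω, g ω * X ω ∂P) (hg : Integrable g P)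
    (hgXi : Integrable (fun ω => g ω * X ω) P) (hd : IsDominated P g) :
    ∀ᵐ ω ∂P, g ω ≤ P.real {ω' | X ω' ≤ X ω} - 1 / 2 := by
  have hm : Measurable fun ω => P.real {ω' | X ω' ≤ X ω} := by
    have : MeasurableSet {q : Ω × Ω | X q.2 ≤ X q.1} :=
      measurableSet_le (hX.comp measurable_snd) (hX.comp measurable_fst)
    exact (measurable_measure_prodMk_left this).ennreal_toReal
  have hi : Integrable (fun ω => P.real {ω' | X ω' ≤ X ω} - 1 / 2) P :=
    (Integrable.of_bound hm.aestronglyMeasurable 1 (Eventually.of_forall fun ω => by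
      rw [Real.norm_eq_abs, abs_of_nonneg measureReal_nonneg]; exact measureReal_le_one)).sub
      (integrable_const _)
  exact ae_le_of_forall_setIntegral_le hg hi fun S hS _ =>
    integral_mul_le_of_isDominated hX hXi hgX hg hgXi hd hS

/-- A subgradient of `meanDiff / 4` at `X` lies between the two versions of the distribution
function of `X`, shifted by `1 / 2`. -/
theorem ae_mem_Icc_cdf_of_isDominated (hX : Measurable X) (hXi : Integrable X P)
    (hgX : 1 / 4 * meanDiff P X ≤ ∫ ω, g ω * X ω ∂P) (hg : Integrable g P)
    (hgXi : Integrable (fun ω => g ω * X ω) P) (hd : IsDominated P g) :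
    ∀ᵐ ω ∂P, g ω ∈ Set.Icc (P.real {ω' | X ω' < X ω} - 1 / 2)
      (P.real {ω' | X ω' ≤ X ω} - 1 / 2) := by
  have hmd : ∀ Z : Ω → ℝ, meanDiff P (fun ω => -Z ω) = meanDiff P Z := fun Z => by
    simp only [meanDiff]
    congr 1 with q
    rw [← abs_neg]; congr 1; ring
  have h := ae_le_cdf_of_isDominated (P := P) (X := fun ω => -X ω) (g := fun ω => -g ω) hX.neg
    hXi.neg (by rw [hmd]; simpa using hgX) hg.neg (by simpa using hgXi) (fun Z hZm hZ => by
      have := hd (fun ω => -Z ω) hZm.neg hZ.neg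
      rw [hmd] at this
      simpa using this)
  filter_upwards [h, ae_le_cdf_of_isDominated hX hXi hgX hg hgXi hd] with ω h1 h2
  refine ⟨?_, h2⟩
  have e : {ω' | -X ω' ≤ -X ω} = {ω' | X ω' < X ω}ᶜ := by
    ext ω'; simp
  rw [e, probReal_compl_eq_one_sub (measurableSet_lt hX measurable_const)] at h1
  linarith

end Interval

section Projection

variable {Ω Ω' : Type*} [MeasurableSpace Ω] [MeasurableSpace Ω']

theorem meanDiff_map {P : Measure Ω} [IsProbabilityMeasure P] {f : Ω → Ω'} (hf : Measurable f)
    {Z : Ω' → ℝ} (hZ : Measurable Z) : meanDiff (P.map f) Z = meanDiff P (fun ω => Z (f ω)) := by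
  rw [meanDiff, meanDiff, Measure.map_prod_map P P hf hf, integral_map (hf.prodMap hf).aemeasurable]
  · rfl
  · exact (((hZ.comp measurable_fst).sub (hZ.comp measurable_snd)).abs).aestronglyMeasurable

theorem midRank_map {P : Measure Ω} {f : Ω → Ω'} (hf : Measurable f) {Z : Ω' → ℝ}
    (hZ : Measurable Z) (ω : Ω) : midRank (P.map f) Z (f ω) = midRank P (fun ω => Z (f ω)) ω := by
  rw [midRank, midRank, integral_map hf.aemeasurable]
  exact (measurable_real_sign.comp (measurable_const.sub hZ)).aestronglyMeasurable

theorem integral_fst_mul_snd {Γ : Measure (Ω × ℝ)} [IsProbabilityMeasure Γ]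
    (hi : Integrable (fun q => q.2) Γ) {f : Ω → ℝ} (hf : Measurable f) {K : ℝ}
    (hK : ∀ p, |f p| ≤ K) : ∫ q, f q.1 * q.2 ∂Γ = ∫ p, f p * ∫ z, z ∂(Γ.condKernel p) ∂Γ.fst := by
  have hfi : Integrable (fun q : Ω × ℝ => f q.1 * q.2) Γ :=
    hi.bdd_mul (c := K) (hf.comp measurable_fst).aestronglyMeasurable
      (Eventually.of_forall fun q => hK q.1)
  rw [← Γ.disintegrate Γ.condKernel] at hfi
  conv_lhs => rw [← Γ.disintegrate Γ.condKernel]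
  rw [Measure.integral_compProd hfi]
  congr 1 with p
  exact integral_const_mul (f p) fun z => z

theorem integrable_integral_condKernel {Γ : Measure (Ω × ℝ)} [IsProbabilityMeasure Γ]
    (hi : Integrable (fun q => q.2) Γ) :
    Integrable (fun p => ∫ z, z ∂(Γ.condKernel p)) Γ.fst := by
  rw [← Γ.disintegrate Γ.condKernel] at hi
  exact Integrable.integral_compProd hi

theorem measurable_integral_condKernel (Γ : Measure (Ω × ℝ)) [IsProbabilityMeasure Γ] :
    Measurable (fun p => ∫ z, z ∂(Γ.condKernel p)) :=
  (StronglyMeasurable.integral_kernel_prod_right (κ := Γ.condKernel) (f := fun _ z => z)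
    measurable_snd.stronglyMeasurable).measurable

theorem IsDominated.fst {Γ : Measure (Ω × ℝ)} [IsProbabilityMeasure Γ]
    {g : Ω → ℝ} (hg : Measurable g) {K : ℝ} (hK : ∀ p, |g p| ≤ K) (hd : IsDominated Γ.fst g)
    (hi : Integrable (fun q => q.2) Γ) :
    ∫ q, g q.1 * q.2 ∂Γ ≤ 1 / 4 * meanDiff Γ Prod.snd := by
  set m : Ω → ℝ := fun p => ∫ z, z ∂(Γ.condKernel p) with hm
  have hmm : Measurable m := measurable_integral_condKernel Γ
  have hmi : Integrable m Γ.fst := integrable_integral_condKernel hi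
  have hms : Measurable fun q : Ω × ℝ => m q.1 := hmm.comp measurable_fst
  calc ∫ q, g q.1 * q.2 ∂Γ = ∫ p, g p * m p ∂Γ.fst := integral_fst_mul_snd hi hg hK
    _ ≤ 1 / 4 * meanDiff Γ.fst m := hd m hmm hmi
    _ = ∫ p, midRank Γ.fst m p * m p ∂Γ.fst := (integral_midRank_mul_self hmm hmi).symm
    _ = ∫ q, midRank Γ.fst m q.1 * q.2 ∂Γ :=
        (integral_fst_mul_snd hi (measurable_midRank hmm) abs_midRank_le).symm
    _ = ∫ q, midRank Γ (fun q => m q.1) q * q.2 ∂Γ := by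
        congr 1 with q
        rw [Measure.fst, midRank_map measurable_fst hmm]
    _ ≤ 1 / 4 * meanDiff Γ Prod.snd := isDominated_midRank hms _ measurable_snd hi

/-- The domination property pulls back along measure preserving projections. -/
theorem IsDominated.comp {Γ : Measure Ω'} [IsProbabilityMeasure Γ] {π : Ω' → Ω}
    (hπ : Measurable π) {g : Ω → ℝ} (hg : Measurable g) {K : ℝ} (hK : ∀ p, |g p| ≤ K)
    (hd : IsDominated (Γ.map π) g) : IsDominated Γ (fun ω => g (π ω)) := by
  intro Z hZm hZ
  have hf : Measurable fun ω => (π ω, Z ω) := hπ.prodMk hZm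
  have : IsProbabilityMeasure (Γ.map fun ω => (π ω, Z ω)) :=
    Measure.isProbabilityMeasure_map hf.aemeasurable
  have h := IsDominated.fst (Γ := Γ.map fun ω => (π ω, Z ω)) hg hK
    (by rwa [Measure.fst_map_prodMk hZm])
    ((integrable_map_measure measurable_snd.aestronglyMeasurable hf.aemeasurable).2 hZ)
  rw [meanDiff_map hf measurable_snd, integral_map hf.aemeasurable] at h
  · exact h
  · exact ((hg.comp measurable_fst).mul measurable_snd).aestronglyMeasurable

end Projection

section GradientFlow

open ProbabilityTheory

section Graph

variable {α E F : Type*} [MeasurableSpace α] [MeasurableSpace E] [MeasurableSpace F]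

/-- The kernel of probability measures (or zero) obtained by normalizing a measurable family. -/
noncomputable def normKernel (ν : α → Measure E)
    (hν : ∀ s, MeasurableSet s → Measurable fun a => ν a s) : Kernel α E where
  toFun a := (ν a Set.univ)⁻¹ • ν a
  measurable' := Measure.measurable_of_measurable_coe _ fun s hs =>
    (hν _ MeasurableSet.univ).inv.mul (hν s hs)

variable {ν : α → Measure E}
  {hν : ∀ s, MeasurableSet s → Measurable fun a => ν a s}

theorem normKernel_apply (a : α) : normKernel ν hν a = (ν a Set.univ)⁻¹ • ν a := rfl

instance : IsFiniteKernel (normKernel ν hν) :=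
  ⟨⟨1, ENNReal.one_lt_top, fun a => by
    rw [normKernel_apply, Measure.smul_apply, smul_eq_mul]
    exact ENNReal.inv_mul_le_one _⟩⟩

theorem smul_normKernel {a : α} (ha : ν a Set.univ ≠ ⊤) :
    ν a Set.univ • normKernel ν hν a = ν a := by
  rw [normKernel_apply]
  rcases eq_or_ne (ν a Set.univ) 0 with h | h
  · rw [h, zero_smul, Measure.measure_univ_eq_zero.1 h]
  · rw [smul_smul, ENNReal.mul_inv_cancel h ha, one_smul]

/-- The measure `∫ δ_a ⊗ ν^a dμ(a)` on the product. -/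
noncomputable def bindGraph (μ : Measure α) (ν : α → Measure E) : Measure (α × E) :=
  μ.bind fun a => (ν a).map (Prod.mk a)

variable {μ : Measure α}

theorem aemeasurable_map_prodMk (hν : ∀ s, MeasurableSet s → Measurable fun a => ν a s)
    (hfin : ∀ᵐ a ∂μ, ν a Set.univ ≠ ⊤) :
    AEMeasurable (fun a => (ν a).map (Prod.mk a)) μ := by
  refine ⟨fun a => (ν a Set.univ • normKernel ν hν a).map (Prod.mk a),
    Measure.measurable_of_measurable_coe _ fun s hs => ?_, ?_⟩
  · simp only [Measure.map_apply measurable_prodMk_left hs, Measure.smul_apply, smul_eq_mul]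
    exact (hν _ MeasurableSet.univ).mul (Kernel.measurable_kernel_prodMk_left hs)
  · filter_upwards [hfin] with a ha
    rw [smul_normKernel ha]

theorem bindGraph_apply (hν : ∀ s, MeasurableSet s → Measurable fun a => ν a s)
    (hfin : ∀ᵐ a ∂μ, ν a Set.univ ≠ ⊤) {s : Set (α × E)}
    (hs : MeasurableSet s) : bindGraph μ ν s = ∫⁻ a, ν a (Prod.mk a ⁻¹' s) ∂μ := by
  rw [bindGraph, Measure.bind_apply hs (aemeasurable_map_prodMk hν hfin)]
  simp only [Measure.map_apply measurable_prodMk_left hs]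

theorem bindGraph_map (hν : ∀ s, MeasurableSet s → Measurable fun a => ν a s)
    (hfin : ∀ᵐ a ∂μ, ν a Set.univ ≠ ⊤) {θ : α → Measure F}
    (hθ : ∀ s, MeasurableSet s → Measurable fun a => θ a s)
    {f : α × E → F} (hf : Measurable f)
    (h : ∀ᵐ a ∂μ, θ a = (ν a).map fun x => f (a, x)) :
    bindGraph μ θ = (bindGraph μ ν).map fun p => (p.1, f p) := by
  have hfa : ∀ a, Measurable fun x => f (a, x) := fun a => hf.comp measurable_prodMk_left
  have hθfin : ∀ᵐ a ∂μ, θ a Set.univ ≠ ⊤ := by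
    filter_upwards [h, hfin] with a ha hna
    rwa [ha, Measure.map_apply (hfa a) MeasurableSet.univ,
      Set.preimage_univ]
  have hm : Measurable fun p : α × E => (p.1, f p) := measurable_fst.prodMk hf
  ext s hs
  rw [Measure.map_apply hm hs, bindGraph_apply hθ hθfin hs,
    bindGraph_apply hν hfin (hm hs)]
  refine lintegral_congr_ae ?_
  filter_upwards [h] with a ha
  rw [ha, Measure.map_apply (hfa a) (measurable_prodMk_left hs)]
  rfl

theorem ae_bindGraph_of_ae_ae (hν : ∀ s, MeasurableSet s → Measurable fun a => ν a s)
    (hfin : ∀ᵐ a ∂μ, ν a Set.univ ≠ ⊤) {p : α × E → Prop}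
    (hp : MeasurableSet {q | p q}) (h : ∀ᵐ a ∂μ, ∀ᵐ x ∂(ν a), p (a, x)) :
    ∀ᵐ q ∂(bindGraph μ ν), p q := by
  change bindGraph μ ν {q | p q}ᶜ = 0
  rw [bindGraph_apply hν hfin hp.compl, ← lintegral_zero (μ := μ)]
  refine lintegral_congr_ae ?_
  filter_upwards [h] with a ha using ha

variable [SFinite μ]

theorem bindGraph_eq_compProd (hfin : ∀ᵐ a ∂μ, ν a Set.univ ≠ ⊤) :
    bindGraph μ ν = (μ.withDensity fun a => ν a Set.univ) ⊗ₘ normKernel ν hν := by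
  ext s hs
  rw [bindGraph_apply hν hfin hs, Measure.compProd_apply hs,
    lintegral_withDensity_eq_lintegral_mul _ (hν _ MeasurableSet.univ)
      (Kernel.measurable_kernel_prodMk_left hs)]
  refine lintegral_congr_ae ?_
  filter_upwards [hfin] with a ha
  conv_lhs => rw [← smul_normKernel (hν := hν) ha]
  rfl

theorem integral_bindGraph (hν : ∀ s, MeasurableSet s → Measurable fun a => ν a s)
    (hfin : ∀ᵐ a ∂μ, ν a Set.univ ≠ ⊤) {f : α × E → ℝ}
    (hf : Integrable f (bindGraph μ ν)) :
    ∫ p, f p ∂(bindGraph μ ν) = ∫ a, ∫ x, f (a, x) ∂(ν a) ∂μ := by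
  rw [bindGraph_eq_compProd (hν := hν) hfin] at hf ⊢
  rw [Measure.integral_compProd hf, integral_withDensity_eq_integral_toReal_smul
    (hν _ MeasurableSet.univ) (by filter_upwards [hfin] with a ha using lt_top_iff_ne_top.2 ha)]
  refine integral_congr_ae ?_
  filter_upwards [hfin] with a ha
  conv_rhs => rw [← smul_normKernel (hν := hν) ha, integral_smul_measure]

theorem ae_integrable_of_integrable_bindGraph
    (hν : ∀ s, MeasurableSet s → Measurable fun a => ν a s)
    (hfin : ∀ᵐ a ∂μ, ν a Set.univ ≠ ⊤) {f : α × E → ℝ} (hf : Integrable f (bindGraph μ ν)) :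
    ∀ᵐ a ∂μ, Integrable (fun x => f (a, x)) (ν a) := by
  rw [bindGraph_eq_compProd (hν := hν) hfin] at hf
  have h := ((Measure.integrable_compProd_iff hf.aestronglyMeasurable).1 hf).1
  rw [ae_withDensity_iff (hν _ MeasurableSet.univ)] at h
  filter_upwards [h, hfin] with a ha hna
  rcases eq_or_ne (ν a Set.univ) 0 with h₀ | h₀
  · rw [Measure.measure_univ_eq_zero.1 h₀]
    exact integrable_zero_measure
  · rw [← smul_normKernel (hν := hν) hna]
    exact (ha h₀).smul_measure hna

end Graph

section Projection

variable {S E : Type*} [MeasurableSpace S] [MeasurableSpace E]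

/-- The joint law of position and velocity, as a kernel. -/
noncomputable def phaseKernel (κ : Kernel S E) (X V : S × E → ℝ) : Kernel S (ℝ × ℝ) :=
  (Kernel.id ×ₖ κ).map fun q => (X q, V q)

instance (κ : Kernel S E) [IsFiniteKernel κ] (X V : S × E → ℝ) :
    IsFiniteKernel (phaseKernel κ X V) := by
  unfold phaseKernel
  infer_instance

/-- The conditional expectation of the truncated velocity given the position. -/
noncomputable def meanVelocity (κ : Kernel S E) [IsFiniteKernel κ] (X V : S × E → ℝ) (C : ℝ)
    (p : S × ℝ) : ℝ :=
  ∫ u, max (-C) (min u C) ∂((phaseKernel κ X V).condKernel p)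

theorem abs_max_min_le {C : ℝ} (hC : 0 ≤ C) (u : ℝ) : |max (-C) (min u C)| ≤ C :=
  abs_le.2 ⟨le_max_left _ _, max_le (by linarith) (min_le_right _ _)⟩

theorem max_min_eq_self {C u : ℝ} (h : |u| ≤ C) : max (-C) (min u C) = u := by
  rw [min_eq_left (abs_le.1 h).2, max_eq_right (abs_le.1 h).1]

theorem measurable_max_min (C : ℝ) : Measurable fun u : ℝ => max (-C) (min u C) :=
  measurable_const.max (measurable_id.min measurable_const)

variable {κ : Kernel S E} [IsFiniteKernel κ] {X V : S × E → ℝ} {C : ℝ}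

theorem measurable_meanVelocity : Measurable (meanVelocity κ X V C) :=
  (StronglyMeasurable.integral_kernel_prod_right (κ := (phaseKernel κ X V).condKernel)
    (f := fun _ u => max (-C) (min u C))
    ((measurable_max_min C).comp measurable_snd).stronglyMeasurable).measurable

theorem abs_meanVelocity_le (hC : 0 ≤ C) (p : S × ℝ) : |meanVelocity κ X V C p| ≤ C := by
  refine (norm_integral_le_of_norm_le_const (C := C) (f := fun u => max (-C) (min u C))
    (Eventually.of_forall fun u => abs_max_min_le hC u)).trans ?_
  rw [probReal_univ, mul_one]

theorem phaseKernel_apply (hX : Measurable X) (hV : Measurable V) (s : S) :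
    phaseKernel κ X V s = (κ s).map fun x => (X (s, x), V (s, x)) := by
  rw [phaseKernel, Kernel.map_apply _ (hX.prodMk hV), Kernel.prod_apply, Kernel.id_apply,
    Measure.dirac_prod, Measure.map_map (hX.prodMk hV) measurable_prodMk_left]
  rfl

theorem integral_mul_meanVelocity (hX : Measurable X) (hV : Measurable V) (hC : 0 ≤ C)
    (hVC : ∀ q, |V q| ≤ C) (s : S) {ψ : ℝ → ℝ} (hψ : Measurable ψ)
    (hi : Integrable (fun x => ψ (X (s, x))) (κ s)) :
    ∫ x, ψ (X (s, x)) * V (s, x) ∂(κ s)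
      = ∫ x, ψ (X (s, x)) * meanVelocity κ X V C (s, X (s, x)) ∂(κ s) := by
  set K := phaseKernel κ X V
  have hXs : Measurable fun x => X (s, x) := hX.comp measurable_prodMk_left
  have hVs : Measurable fun x => V (s, x) := hV.comp measurable_prodMk_left
  have hXV := hXs.prodMk hVs
  have hF : Measurable fun q : ℝ × ℝ => ψ q.1 * max (-C) (min q.2 C) :=
    (hψ.comp measurable_fst).mul ((measurable_max_min C).comp measurable_snd)
  have hFi : Integrable (fun q : ℝ × ℝ => ψ q.1 * max (-C) (min q.2 C)) (K s) := by
    rw [phaseKernel_apply hX hV, integrable_map_measure hF.aestronglyMeasurable hXV.aemeasurable]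
    exact hi.mul_bdd (c := C) (((measurable_max_min C).comp hVs)).aestronglyMeasurable
      (Eventually.of_forall fun x => abs_max_min_le hC _)
  have h₁ : ∫ q, ψ q.1 * max (-C) (min q.2 C) ∂(K s) = ∫ x, ψ (X (s, x)) * V (s, x) ∂(κ s) := by
    rw [phaseKernel_apply hX hV, integral_map hXV.aemeasurable hF.aestronglyMeasurable]
    simp only [max_min_eq_self (hVC _)]
  have hfst : K.fst s = (κ s).map fun x => X (s, x) := by
    rw [Kernel.fst_apply, phaseKernel_apply hX hV, Measure.map_map measurable_fst hXV]
    rfl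
  rw [← h₁]
  conv_lhs => rw [← K.disintegrate K.condKernel]
  rw [← K.disintegrate K.condKernel] at hFi
  rw [ProbabilityTheory.integral_compProd hFi, hfst, integral_map hXs.aemeasurable]
  · simp only [integral_const_mul]
    rfl
  · simp only [integral_const_mul]
    exact (hψ.mul (measurable_meanVelocity.comp measurable_prodMk_left)).aestronglyMeasurable

end Projection

section Continuity

variable {φ : ℝ → ℝ → ℝ}

theorem hasDerivAt_curry_left (hφ : ContDiff ℝ 1 (Function.uncurry φ)) (t y : ℝ) :
    HasDerivAt (fun s => φ s y) (fderiv ℝ (Function.uncurry φ) (t, y) (1, 0)) t :=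
  (hφ.differentiable one_ne_zero (t, y)).hasFDerivAt.comp_hasDerivAt (f := fun s => (s, y)) t
    ((hasDerivAt_id t).prodMk (hasDerivAt_const t y))

theorem hasDerivAt_curry_right (hφ : ContDiff ℝ 1 (Function.uncurry φ)) (t y : ℝ) :
    HasDerivAt (fun z => φ t z) (fderiv ℝ (Function.uncurry φ) (t, y) (0, 1)) y :=
  (hφ.differentiable one_ne_zero (t, y)).hasFDerivAt.comp_hasDerivAt (f := fun z => (t, z)) y
    ((hasDerivAt_const y t).prodMk (hasDerivAt_id y))

theorem hasDerivAt_curry_comp (hφ : ContDiff ℝ 1 (Function.uncurry φ)) {x : ℝ → ℝ} {t u : ℝ}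
    (hx : HasDerivAt x u t) : HasDerivAt (fun s => φ s (x s))
      (deriv (fun s => φ s (x t)) t + deriv (fun y => φ t y) (x t) * u) t := by
  rw [(hasDerivAt_curry_left hφ _ _).deriv, (hasDerivAt_curry_right hφ _ _).deriv]
  have h : HasDerivAt (fun s => φ s (x s)) (fderiv ℝ (Function.uncurry φ) (t, x t) (1, u)) t :=
    (hφ.differentiable one_ne_zero (t, x t)).hasFDerivAt.comp_hasDerivAt (f := fun s => (s, x s)) t
      ((hasDerivAt_id t).prodMk hx)
  have hu : ((1 : ℝ), u) = (1, 0) + u • (0, 1) := by simp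
  rwa [hu, map_add, map_smul, smul_eq_mul, mul_comm] at h

theorem integral_deriv_along_curve (hφ : ContDiff ℝ 1 (Function.uncurry φ))
    (hc : HasCompactSupport (Function.uncurry φ)) {x u : ℝ → ℝ} {C T : ℝ} (hT : 0 ≤ T)
    (hL : ∀ s t, |x t - x s| ≤ C * |t - s|) (hx : ∀ᵐ t, HasDerivAt x (u t) t) :
    ∫ t in Set.Icc (0 : ℝ) T, (deriv (fun s => φ s (x t)) t + deriv (fun y => φ t y) (x t) * u t)
      = φ T (x T) - φ 0 (x 0) := by
  obtain ⟨K, hK⟩ := hφ.lipschitzWith_of_hasCompactSupport hc one_ne_zero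
  have hC : LipschitzWith C.toNNReal x := LipschitzWith.of_dist_le_mul fun t s => by
    rw [Real.dist_eq, Real.dist_eq]
    exact (hL s t).trans (mul_le_mul_of_nonneg_right (Real.le_coe_toNNReal C) (abs_nonneg _))
  have hl : LipschitzWith (K * max 1 C.toNNReal) fun t => φ t (x t) :=
    hK.comp (LipschitzWith.id.prodMk hC)
  have hac := (hl.lipschitzOnWith (s := Set.uIcc 0 T)).absolutelyContinuousOnInterval
  rw [← hac.integral_deriv_eq_sub, intervalIntegral.integral_of_le hT,
    ← integral_Icc_eq_integral_Ioc]
  refine setIntegral_congr_ae measurableSet_Icc ?_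
  filter_upwards [hx] with t ht _ using (hasDerivAt_curry_comp hφ ht).deriv.symm

theorem solvesContinuity_of_flow {E : Type*} [MeasurableSpace E] {m : Measure E}
    [IsFiniteMeasure m] {X V : ℝ → E → ℝ} {C T : ℝ} (hT : 0 ≤ T)
    (hX : Measurable fun p : ℝ × E => X p.1 p.2) (hV : Measurable fun p : ℝ × E => V p.1 p.2)
    (hVC : ∀ t x, |V t x| ≤ C) (hL : ∀ s t x, |X t x - X s x| ≤ C * |t - s|)
    (hXV : ∀ x, ∀ᵐ t, HasDerivAt (fun s => X s x) (V t x) t)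
    {v : ℝ → ℝ → ℝ} (hv : ∀ t, Measurable (v t)) (hvC : ∀ t y, |v t y| ≤ C)
    (hvV : ∀ t, ∀ ψ : ℝ → ℝ, Measurable ψ → Integrable (fun x => ψ (X t x)) m →
      ∫ x, ψ (X t x) * V t x ∂m = ∫ x, ψ (X t x) * v t (X t x) ∂m) :
    SolvesContinuity T (fun t => m.map (X t)) v := by
  intro φ hφ hc
  have hXt : ∀ t, Measurable (X t) := fun t => hX.comp measurable_prodMk_left
  have hVt : ∀ t, Measurable (V t) := fun t => hV.comp measurable_prodMk_left
  have hD : ∀ w : ℝ × ℝ, Continuous fun q => fderiv ℝ (Function.uncurry φ) q w := fun w =>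
    (hφ.continuous_fderiv one_ne_zero).clm_apply continuous_const
  have hDb : ∀ w : ℝ × ℝ, ∃ M : ℝ, ∀ q, ‖fderiv ℝ (Function.uncurry φ) q w‖ ≤ M := fun w =>
    ((hc.fderiv_apply ℝ w)).exists_bound_of_continuous (hD w)
  obtain ⟨M₁, hM₁⟩ := hDb (1, 0)
  obtain ⟨M₂, hM₂⟩ := hDb (0, 1)
  have hdt : ∀ t y, deriv (fun s => φ s y) t = fderiv ℝ (Function.uncurry φ) (t, y) (1, 0) :=
    fun t y => (hasDerivAt_curry_left hφ t y).deriv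
  have hdy : ∀ t y, deriv (fun z => φ t z) y = fderiv ℝ (Function.uncurry φ) (t, y) (0, 1) :=
    fun t y => (hasDerivAt_curry_right hφ t y).deriv
  have hφt : ∀ t, Continuous (φ t) := fun t => hφ.continuous.comp (Continuous.prodMk_right t)
  obtain ⟨M₀, hM₀⟩ := hc.exists_bound_of_continuous hφ.continuous
  have hi₀ : ∀ t, Integrable (fun x => φ t (X t x)) m := fun t =>
    .of_bound ((hφt t).measurable.comp (hXt t)).aestronglyMeasurable M₀
      (Eventually.of_forall fun x => hM₀ (t, X t x))
  have hgen : ∀ w : ℝ × ℝ, ∀ t, Measurable fun y => fderiv ℝ (Function.uncurry φ) (t, y) w :=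
    fun w t => ((hD w).comp (Continuous.prodMk_right t)).measurable
  have hi₁ : ∀ t, Integrable (fun x => fderiv ℝ (Function.uncurry φ) (t, X t x) (1, 0)) m :=
    fun t => .of_bound ((hgen _ t).comp (hXt t)).aestronglyMeasurable M₁
      (Eventually.of_forall fun x => hM₁ _)
  have hi₂ : ∀ t, Integrable (fun x => fderiv ℝ (Function.uncurry φ) (t, X t x) (0, 1)) m :=
    fun t => .of_bound ((hgen _ t).comp (hXt t)).aestronglyMeasurable M₂
      (Eventually.of_forall fun x => hM₂ _)
  have hstep : ∀ t,
      ∫ y, (deriv (fun s => φ s y) t + deriv (fun z => φ t z) y * v t y) ∂(m.map (X t))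
      = ∫ x, (deriv (fun s => φ s (X t x)) t + deriv (fun z => φ t z) (X t x) * V t x) ∂m := by
    intro t
    simp only [hdt, hdy]
    have hm : Measurable fun y => fderiv ℝ (Function.uncurry φ) (t, y) (1, 0)
        + fderiv ℝ (Function.uncurry φ) (t, y) (0, 1) * v t y :=
      (hgen _ t).add ((hgen _ t).mul (hv t))
    rw [integral_map (hXt t).aemeasurable hm.aestronglyMeasurable, integral_add (hi₁ t),
      integral_add (hi₁ t), hvV t _ (hgen _ t) (hi₂ t)]
    · exact (hi₂ t).mul_bdd (c := C) (hVt t).aestronglyMeasurable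
        (Eventually.of_forall fun x => hVC t x)
    · exact (hi₂ t).mul_bdd (c := C) ((hv t).comp (hXt t)).aestronglyMeasurable
        (Eventually.of_forall fun x => hvC t _)
  simp only [hstep]
  rw [integral_integral_swap]
  · rw [integral_map (hXt T).aemeasurable (hφt T).aestronglyMeasurable,
      integral_map (hXt 0).aemeasurable (hφt 0).aestronglyMeasurable,
      ← integral_sub (hi₀ T) (hi₀ 0)]
    refine integral_congr_ae (Eventually.of_forall fun x => ?_)
    exact integral_deriv_along_curve hφ hc hT (fun s t => hL s t x) (hXV x)
  · simp only [hdt, hdy]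
    have hpair : Measurable fun q : ℝ × E => (q.1, X q.1 q.2) := measurable_fst.prodMk hX
    refine .of_bound (((hD _).measurable.comp hpair).add
      (((hD _).measurable.comp hpair).mul hV)).aestronglyMeasurable (M₁ + M₂ * C)
      (Eventually.of_forall fun q => (norm_add_le _ _).trans (add_le_add (hM₁ _) ?_))
    change ‖fderiv ℝ (Function.uncurry φ) (q.1, X q.1 q.2) (0, 1) * V q.1 q.2‖ ≤ M₂ * C
    rw [norm_mul]
    exact mul_le_mul (hM₂ _) (hVC _ _) (norm_nonneg _) ((norm_nonneg _).trans (hM₂ 0))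

end Continuity

section Subdifferential

variable {μ : Measure ℝ} {h : ℝ → ℝ}

theorem IsXR.mass_ne_top {R : ℝ} {ν : ℝ → Measure ℝ} (hν : IsXR μ h R ν) :
    ∀ᵐ a ∂μ, ν a Set.univ ≠ ⊤ := by
  filter_upwards [hν.mass] with a ha
  rw [ha]
  exact ENNReal.ofReal_ne_top

theorem nuOtimes_eq_bindGraph (ν : ℝ → Measure ℝ) : nuOtimes μ ν = bindGraph μ ν := rfl

theorem J0_eq_meanDiff (ν : ℝ → Measure ℝ) : J0 μ ν = meanDiff (nuOtimes μ ν) Prod.snd := rfl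

theorem IsXR.ae_abs_le {R : ℝ} {ν : ℝ → Measure ℝ} (hν : IsXR μ h R ν) :
    ∀ᵐ a ∂μ, ∀ᵐ x ∂(ν a), |x| ≤ R := by
  filter_upwards [hν.supp] with a ha
  filter_upwards [mem_ae_iff.2 ha] with x hx using abs_le.2 hx

theorem IsXR.ae_nuOtimes_abs_le {R : ℝ} {ν : ℝ → Measure ℝ} (hν : IsXR μ h R ν) :
    ∀ᵐ p ∂(nuOtimes μ ν), |p.2| ≤ R :=
  ae_bindGraph_of_ae_ae hν.meas hν.mass_ne_top
    (measurableSet_le measurable_snd.abs measurable_const) hν.ae_abs_le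

theorem IsXR.ae_nuOtimes_of_ae {R : ℝ} {ν : ℝ → Measure ℝ} (hν : IsXR μ h R ν) {q : ℝ → Prop}
    (hq : MeasurableSet {a | q a}) (hμ : ∀ᵐ a ∂μ, q a) : ∀ᵐ p ∂(nuOtimes μ ν), q p.1 :=
  ae_bindGraph_of_ae_ae hν.meas hν.mass_ne_top (measurable_fst hq)
    (hμ.mono fun _ ha => Eventually.of_forall fun _ => ha)

variable {R M K : ℝ} {ν : ℝ → Measure ℝ} [IsProbabilityMeasure (nuOtimes μ ν)]
  {g : ℝ × ℝ → ℝ} {w : ℝ → ℝ → ℝ}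

theorem inSubdiff_of_isDominated [SigmaFinite μ] (hν : IsXR μ h R ν) (hM : ∀ᵐ a ∂μ, |a| ≤ M)
    (hg : Measurable g) (hK : ∀ p, |g p| ≤ K) (hw : Measurable fun p : ℝ × ℝ => w p.1 p.2)
    (hgw : ∀ᵐ a ∂μ, ∀ y, g (a, y) = w a y + a - 1 / 2) (hd : IsDominated (nuOtimes μ ν) g)
    (hgX : 1 / 4 * meanDiff (nuOtimes μ ν) Prod.snd ≤ ∫ p, g p * p.2 ∂(nuOtimes μ ν)) :
    InSubdiff μ h ν w := by
  have hwb : ∀ᵐ a ∂μ, ∀ y, |w a y| ≤ K + 1 / 2 + M := by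
    filter_upwards [hM, hgw] with a ha hga y
    have h₁ := abs_le.1 (hK (a, y))
    have h₂ := abs_le.1 ha
    rw [hga y] at h₁
    exact abs_le.2 ⟨by linarith, by linarith⟩
  refine ⟨.of_bound hw.aestronglyMeasurable (K + 1 / 2 + M) ?_, fun R' _ θ hθ γ hγ => ?_⟩
  · exact ae_bindGraph_of_ae_ae hν.meas hν.mass_ne_top
      (measurableSet_le hw.abs measurable_const)
      (hwb.mono fun a ha => Eventually.of_forall fun y => ha y)
  have hγfin : ∀ᵐ a ∂μ, γ a Set.univ ≠ ⊤ := by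
    filter_upwards [hγ.fst, hν.mass_ne_top] with a ha hna
    rwa [← ha, Measure.map_apply measurable_fst MeasurableSet.univ, Set.preimage_univ] at hna
  set Γ := bindGraph μ γ with hΓ
  have hπ : Measurable fun q : ℝ × ℝ × ℝ => (q.1, q.2.1) :=
    measurable_fst.prodMk (measurable_fst.comp measurable_snd)
  have hσ : Measurable fun q : ℝ × ℝ × ℝ => (q.1, q.2.2) :=
    measurable_fst.prodMk (measurable_snd.comp measurable_snd)
  have hΛ : nuOtimes μ ν = Γ.map fun q => (q.1, q.2.1) :=
    bindGraph_map hγ.meas hγfin hν.meas (measurable_fst.comp measurable_snd)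
      (hγ.fst.mono fun _ ha => ha.symm)
  have hΘ : nuOtimes μ θ = Γ.map fun q => (q.1, q.2.2) :=
    bindGraph_map hγ.meas hγfin hθ.meas (measurable_snd.comp measurable_snd)
      (hγ.snd.mono fun _ ha => ha.symm)
  have : IsProbabilityMeasure Γ := ⟨by
    rw [← measure_univ (μ := nuOtimes μ ν), hΛ, Measure.map_apply hπ MeasurableSet.univ,
      Set.preimage_univ]⟩
  have hy : ∀ᵐ q ∂Γ, |q.2.1| ≤ R := ae_of_ae_map hπ.aemeasurable (hΛ ▸ hν.ae_nuOtimes_abs_le)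
  have hz : ∀ᵐ q ∂Γ, |q.2.2| ≤ R' := ae_of_ae_map hσ.aemeasurable (hΘ ▸ hθ.ae_nuOtimes_abs_le)
  have ha : ∀ᵐ q ∂Γ, |q.1| ≤ M := ae_of_ae_map hπ.aemeasurable
    (hΛ ▸ hν.ae_nuOtimes_of_ae (measurableSet_le measurable_id.abs measurable_const) hM)
  have hgΓ : ∀ᵐ q ∂Γ, g (q.1, q.2.1) = w q.1 q.2.1 + q.1 - 1 / 2 :=
    ae_bindGraph_of_ae_ae hγ.meas hγfin
      (measurableSet_eq_fun (hg.comp hπ) (((hw.comp hπ).add measurable_fst).sub measurable_const))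
      (hgw.mono fun a ha => Eventually.of_forall fun y => ha _)
  have hmy : Measurable fun q : ℝ × ℝ × ℝ => q.2.1 := measurable_fst.comp measurable_snd
  have hmz : Measurable fun q : ℝ × ℝ × ℝ => q.2.2 := measurable_snd.comp measurable_snd
  have hyi : Integrable (fun q : ℝ × ℝ × ℝ => q.2.1) Γ := .of_bound hmy.aestronglyMeasurable R hy
  have hzi : Integrable (fun q : ℝ × ℝ × ℝ => q.2.2) Γ := .of_bound hmz.aestronglyMeasurable R' hz
  have hgm : Measurable fun q : ℝ × ℝ × ℝ => g (q.1, q.2.1) := hg.comp hπ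
  have hgb : ∀ f : ℝ × ℝ × ℝ → ℝ, Integrable f Γ →
      Integrable (fun q => g (q.1, q.2.1) * f q) Γ := fun f hf =>
    hf.bdd_mul (c := K) hgm.aestronglyMeasurable (Eventually.of_forall fun q => hK _)
  have hab : ∀ f : ℝ × ℝ × ℝ → ℝ, Integrable f Γ →
      Integrable (fun q => (1 / 2 - q.1) * f q) Γ := fun f hf =>
    hf.bdd_mul (c := 1 / 2 + M) (measurable_const.sub measurable_fst).aestronglyMeasurable (by
      filter_upwards [ha] with q hq
      have := abs_le.1 hq
      exact abs_le.2 ⟨by linarith, by linarith⟩)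
  have hwi : Integrable (fun q : ℝ × ℝ × ℝ => w q.1 q.2.1 * (q.2.2 - q.2.1)) Γ := by
    refine (hzi.sub hyi).bdd_mul (c := K + 1 / 2 + M) (hw.comp hπ).aestronglyMeasurable ?_
    exact ae_bindGraph_of_ae_ae hγ.meas hγfin
      (measurableSet_le (hw.comp hπ).abs measurable_const)
      (hwb.mono fun a ha => Eventually.of_forall fun y => ha _)
  have hJ : ∀ f : ℝ × ℝ → ℝ, Measurable f → ∀ u : ℝ × ℝ × ℝ → ℝ × ℝ, Measurable u →
      ∫ p, f p ∂(Γ.map u) = ∫ q, f (u q) ∂Γ := fun f hf u hu =>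
    integral_map hu.aemeasurable hf.aestronglyMeasurable
  have hJm : Measurable fun p : ℝ × ℝ => (1 / 2 - p.1) * p.2 :=
    (measurable_const.sub measurable_fst).mul measurable_snd
  rw [← integral_bindGraph hγ.meas hγfin hwi]
  have hdom : ∫ q, g (q.1, q.2.1) * q.2.2 ∂Γ ≤ 1 / 4 * meanDiff Γ fun q => q.2.2 :=
    IsDominated.comp hπ hg hK (hΛ ▸ hd) (fun q => q.2.2) hmz hzi
  rw [hΛ, meanDiff_map hπ measurable_snd,
    hJ (fun p => g p * p.2) (hg.mul measurable_snd) _ hπ] at hgX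
  rw [Jen, Jen, J0_eq_meanDiff, J0_eq_meanDiff, J1, J1, hΛ, hΘ, meanDiff_map hπ measurable_snd,
    meanDiff_map hσ measurable_snd, hJ _ hJm _ hπ, hJ _ hJm _ hσ]
  have hsplit : ∫ q, w q.1 q.2.1 * (q.2.2 - q.2.1) ∂Γ
      = (∫ q, g (q.1, q.2.1) * q.2.2 ∂Γ - ∫ q, g (q.1, q.2.1) * q.2.1 ∂Γ)
        + (∫ q, (1 / 2 - q.1) * q.2.2 ∂Γ - ∫ q, (1 / 2 - q.1) * q.2.1 ∂Γ) := by
    have hi₁ : Integrable (fun q => g (q.1, q.2.1) * q.2.2 - g (q.1, q.2.1) * q.2.1) Γ :=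
      (hgb _ hzi).sub (hgb _ hyi)
    have hi₂ : Integrable (fun q => (1 / 2 - q.1) * q.2.2 - (1 / 2 - q.1) * q.2.1) Γ :=
      (hab _ hzi).sub (hab _ hyi)
    rw [← integral_sub (hgb _ hzi) (hgb _ hyi), ← integral_sub (hab _ hzi) (hab _ hyi),
      ← integral_add hi₁ hi₂]
    refine integral_congr_ae ?_
    filter_upwards [hgΓ] with q hq
    rw [hq]
    ring
  rw [hsplit]
  linarith

theorem ae_velocity_mem_Icc (hν : IsXR μ h R ν)
    (hg : Measurable g) (hK : ∀ p, |g p| ≤ K) (hw : Measurable fun p : ℝ × ℝ => w p.1 p.2)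
    (hgw : ∀ᵐ a ∂μ, ∀ y, g (a, y) = w a y + a - 1 / 2) (hd : IsDominated (nuOtimes μ ν) g)
    (hgX : 1 / 4 * meanDiff (nuOtimes μ ν) Prod.snd ≤ ∫ p, g p * p.2 ∂(nuOtimes μ ν)) :
    ∀ᵐ p ∂(nuOtimes μ ν),
      -w p.1 p.2 ∈ Set.Icc (p.1 - Gcdf μ ν p.2) (p.1 - GcdfM μ ν p.2) := by
  have hxi : Integrable (Prod.snd : ℝ × ℝ → ℝ) (nuOtimes μ ν) :=
    .of_bound measurable_snd.aestronglyMeasurable R hν.ae_nuOtimes_abs_le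
  have hgi : Integrable g (nuOtimes μ ν) :=
    .of_bound hg.aestronglyMeasurable K (Eventually.of_forall hK)
  have hgw' : ∀ᵐ p ∂(nuOtimes μ ν), g p = w p.1 p.2 + p.1 - 1 / 2 :=
    ae_bindGraph_of_ae_ae hν.meas hν.mass_ne_top
      (measurableSet_eq_fun hg ((hw.add measurable_fst).sub measurable_const))
      (hgw.mono fun a ha => Eventually.of_forall fun y => ha _)
  filter_upwards [hgw', ae_mem_Icc_cdf_of_isDominated measurable_snd hxi hgX hgi
    (hxi.bdd_mul hg.aestronglyMeasurable (Eventually.of_forall hK)) hd] with p hp hIcc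
  have h₁ : Gcdf μ ν p.2 = (nuOtimes μ ν).real {q | q.2 ≤ p.2} := by
    rw [Gcdf, barNu, Measure.map_apply measurable_snd measurableSet_Iic]
    rfl
  have h₂ : GcdfM μ ν p.2 = (nuOtimes μ ν).real {q | q.2 < p.2} := by
    rw [GcdfM, barNu, Measure.map_apply measurable_snd measurableSet_Iio]
    rfl
  rw [hp, ← h₁, ← h₂] at hIcc
  exact ⟨by linarith [hIcc.2], by linarith [hIcc.1]⟩

end Subdifferential

section PushFamily

open Classical in
/-- Fibrewise push-forward of a family of measures under `X (a, ·)`, leaving infinite measures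
unchanged. -/
noncomputable def pushFamily (ν : ℝ → Measure ℝ) (X : ℝ × ℝ → ℝ) (a : ℝ) : Measure ℝ :=
  if ν a Set.univ = ⊤ then ν a else (ν a).map fun x => X (a, x)

variable {μ : Measure ℝ} {h : ℝ → ℝ} {R : ℝ} {ν : ℝ → Measure ℝ} {X Y : ℝ × ℝ → ℝ}

theorem pushFamily_of_ne_top {a : ℝ} (ha : ν a Set.univ ≠ ⊤) :
    pushFamily ν X a = (ν a).map fun x => X (a, x) := if_neg ha

theorem pushFamily_snd : pushFamily ν Prod.snd = ν := by
  funext a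
  rw [pushFamily]
  split_ifs with ha
  · rfl
  · exact Measure.map_id

theorem measurable_pushFamily (hν : ∀ s, MeasurableSet s → Measurable fun a => ν a s)
    (hX : Measurable X) {s : Set ℝ} (hs : MeasurableSet s) :
    Measurable fun a => pushFamily ν X a s := by
  classical
  have hX' : ∀ a, Measurable fun x => X (a, x) := fun a => hX.comp measurable_prodMk_left
  have h₁ : (fun a => pushFamily ν X a s) = fun a => if ν a Set.univ = ⊤ then ν a s else
      ν a Set.univ * normKernel ν hν a (Prod.mk a ⁻¹' (X ⁻¹' s)) := by
    funext a
    by_cases ha : ν a Set.univ = ⊤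
    · rw [pushFamily, if_pos ha, if_pos ha]
    · rw [pushFamily_of_ne_top ha, if_neg ha, Measure.map_apply (hX' a) hs]
      conv_lhs => rw [← smul_normKernel (hν := hν) ha]
      rfl
  rw [h₁]
  exact Measurable.ite (measurableSet_eq_fun (hν _ MeasurableSet.univ) measurable_const) (hν s hs)
    ((hν _ MeasurableSet.univ).mul (Kernel.measurable_kernel_prodMk_left (hX hs)))

theorem isXR_pushFamily (hν : IsXR μ h R ν) (hX : Measurable X) {r R' : ℝ}
    (hr : ∀ p, |X p - p.2| ≤ r) (hR : R + r ≤ R') : IsXR μ h R' (pushFamily ν X) where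
  meas s hs := measurable_pushFamily hν.meas hX hs
  mass := by
    filter_upwards [hν.mass, hν.mass_ne_top] with a ha hna
    have hXa : Measurable fun x => X (a, x) := hX.comp measurable_prodMk_left
    rw [pushFamily_of_ne_top hna, Measure.map_apply hXa MeasurableSet.univ, Set.preimage_univ, ha]
  supp := by
    filter_upwards [hν.ae_abs_le, hν.mass_ne_top] with a ha hna
    have hXa : Measurable fun x => X (a, x) := hX.comp measurable_prodMk_left
    rw [pushFamily_of_ne_top hna, Measure.map_apply hXa measurableSet_Icc.compl]
    change ∀ᵐ x ∂(ν a), X (a, x) ∈ Set.Icc (-R') R'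
    filter_upwards [ha] with x hx
    have h₁ := abs_le.1 (hr (a, x))
    have h₂ := abs_le.1 hx
    exact ⟨by linarith, by linarith⟩

theorem nuOtimes_pushFamily (hν : IsXR μ h R ν) (hX : Measurable X) :
    nuOtimes μ (pushFamily ν X) = (nuOtimes μ ν).map fun p => (p.1, X p) :=
  bindGraph_map hν.meas hν.mass_ne_top (fun _ hs => measurable_pushFamily hν.meas hX hs) hX
    (hν.mass_ne_top.mono fun _ ha => pushFamily_of_ne_top ha)

theorem W2sq_map_le {m : Measure ℝ} [IsFiniteMeasure m] {f g : ℝ → ℝ} (hf : Measurable f)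
    (hg : Measurable g) {δ : ℝ} (hδ : ∀ x, |f x - g x| ≤ δ) :
    W2sq (m.map f) (m.map g) ≤ δ ^ 2 * m.real Set.univ := by
  have hfg := hf.prodMk hg
  have hbdd : BddBelow {r : ℝ | ∃ γ : Measure (ℝ × ℝ), γ.map Prod.fst = m.map f ∧
      γ.map Prod.snd = m.map g ∧ r = ∫ p, (p.1 - p.2) ^ 2 ∂γ} := by
    refine ⟨0, ?_⟩
    rintro _ ⟨γ, -, -, rfl⟩
    exact integral_nonneg fun p => sq_nonneg _
  refine (csInf_le hbdd ⟨m.map fun x => (f x, g x), ?_, ?_, rfl⟩).trans ?_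
  · rw [Measure.map_map measurable_fst hfg]
    rfl
  · rw [Measure.map_map measurable_snd hfg]
    rfl
  · have hm : Measurable fun p : ℝ × ℝ => (p.1 - p.2) ^ 2 :=
      (measurable_fst.sub measurable_snd).pow_const 2
    rw [integral_map hfg.aemeasurable hm.aestronglyMeasurable]
    refine (le_abs_self _).trans (norm_integral_le_of_norm_le_const
      (f := fun x => (f x - g x) ^ 2) (Eventually.of_forall fun x => ?_))
    rw [Real.norm_eq_abs, abs_pow]
    exact pow_le_pow_left₀ (abs_nonneg _) (hδ x) 2

theorem W2sq_nonneg (m n : Measure ℝ) : 0 ≤ W2sq m n :=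
  Real.sInf_nonneg (by
    rintro _ ⟨γ, -, -, rfl⟩
    exact integral_nonneg fun p => sq_nonneg _)

theorem sqrt_dsq_pushFamily_le (hν : IsXR μ h R ν) (hh : ∀ a, 0 ≤ h a) (hhi : Integrable h μ)
    (hX : Measurable X) (hY : Measurable Y) {δ : ℝ} (hδ : ∀ p, |X p - Y p| ≤ δ) :
    √(dsq μ (pushFamily ν X) (pushFamily ν Y)) ≤ √(∫ a, h a ∂μ) * δ := by
  have hδ₀ : 0 ≤ δ := (abs_nonneg _).trans (hδ 0)
  rw [Real.sqrt_le_iff]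
  refine ⟨mul_nonneg (Real.sqrt_nonneg _) hδ₀, ?_⟩
  rw [mul_pow, Real.sq_sqrt (integral_nonneg hh), mul_comm, ← integral_const_mul]
  refine integral_mono_of_nonneg (Eventually.of_forall fun a => W2sq_nonneg _ _)
    (hhi.const_mul _) ?_
  filter_upwards [hν.mass, hν.mass_ne_top] with a ha hna
  have : IsFiniteMeasure (ν a) := ⟨lt_top_iff_ne_top.2 hna⟩
  rw [pushFamily_of_ne_top hna, pushFamily_of_ne_top hna]
  refine (W2sq_map_le (hX.comp measurable_prodMk_left) (hY.comp measurable_prodMk_left)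
    fun x => hδ (a, x)).trans_eq ?_
  rw [Measure.real, ha, ENNReal.toReal_ofReal (hh a)]

end PushFamily

section FlowVelocity

variable {ν : ℝ → Measure ℝ} {hν : ∀ s, MeasurableSet s → Measurable fun a => ν a s}
  {X V : ℝ → ℝ × ℝ → ℝ} {C : ℝ}

/-- The velocity field at time `t` and label `a`, obtained by averaging the Lagrangian velocity
over all particles with label `a` at the same position. -/
noncomputable def eulerianVelocity (ν : ℝ → Measure ℝ)
    (hν : ∀ s, MeasurableSet s → Measurable fun a => ν a s) (X V : ℝ → ℝ × ℝ → ℝ)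
    (C t a y : ℝ) : ℝ :=
  meanVelocity ((normKernel ν hν).comap (Prod.snd : ℝ × ℝ → ℝ) measurable_snd)
    (fun q => X q.1.1 (q.1.2, q.2)) (fun q => V q.1.1 (q.1.2, q.2)) C ((t, a), y)

theorem measurable_eulerianVelocity :
    Measurable fun p : ℝ × ℝ × ℝ => eulerianVelocity ν hν X V C p.1 p.2.1 p.2.2 :=
  measurable_meanVelocity.comp ((measurable_fst.prodMk (measurable_fst.comp measurable_snd)).prodMk
    (measurable_snd.comp measurable_snd))

theorem abs_eulerianVelocity_le (hC : 0 ≤ C) (t a y : ℝ) :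
    |eulerianVelocity ν hν X V C t a y| ≤ C := abs_meanVelocity_le hC _

theorem integral_mul_eulerianVelocity (hX : Measurable fun p : ℝ × ℝ × ℝ => X p.1 p.2)
    (hV : Measurable fun p : ℝ × ℝ × ℝ => V p.1 p.2) (hC : 0 ≤ C) (hVC : ∀ t p, |V t p| ≤ C)
    {a : ℝ} (ha : ν a Set.univ ≠ ⊤) (t : ℝ) {ψ : ℝ → ℝ} (hψ : Measurable ψ)
    (hi : Integrable (fun x => ψ (X t (a, x))) (ν a)) :
    ∫ x, ψ (X t (a, x)) * V t (a, x) ∂(ν a)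
      = ∫ x, ψ (X t (a, x)) * eulerianVelocity ν hν X V C t a (X t (a, x)) ∂(ν a) := by
  rcases eq_or_ne (ν a Set.univ) 0 with h₀ | h₀
  · rw [Measure.measure_univ_eq_zero.1 h₀, integral_zero_measure, integral_zero_measure]
  have hm : Measurable fun q : (ℝ × ℝ) × ℝ => (q.1.1, q.1.2, q.2) :=
    (measurable_fst.comp measurable_fst).prodMk
      ((measurable_snd.comp measurable_fst).prodMk measurable_snd)
  have h := integral_mul_meanVelocity
    (κ := (normKernel ν hν).comap (Prod.snd : ℝ × ℝ → ℝ) measurable_snd)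
    (X := fun q => X q.1.1 (q.1.2, q.2)) (V := fun q => V q.1.1 (q.1.2, q.2))
    (hX.comp hm) (hV.comp hm) hC (fun q => hVC _ _) (t, a) hψ
    (hi.smul_measure (ENNReal.inv_ne_top.2 h₀))
  conv_lhs => rw [← smul_normKernel (hν := hν) ha, integral_smul_measure]
  conv_rhs => rw [← smul_normKernel (hν := hν) ha, integral_smul_measure]
  exact congrArg _ h

variable {μ : Measure ℝ} [SigmaFinite μ]

theorem integral_nuOtimes_mul_eulerianVelocity (hX : Measurable fun p : ℝ × ℝ × ℝ => X p.1 p.2)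
    (hV : Measurable fun p : ℝ × ℝ × ℝ => V p.1 p.2) (hC : 0 ≤ C) (hVC : ∀ t p, |V t p| ≤ C)
    (hfin : ∀ᵐ a ∂μ, ν a Set.univ ≠ ⊤) (t : ℝ) {Z : ℝ × ℝ → ℝ} (hZ : Measurable Z)
    (hi : Integrable (fun p => Z (p.1, X t p)) (nuOtimes μ ν)) :
    ∫ p, V t p * Z (p.1, X t p) ∂(nuOtimes μ ν)
      = ∫ p, eulerianVelocity ν hν X V C t p.1 (X t p) * Z (p.1, X t p) ∂(nuOtimes μ ν) := by
  have hXt : Measurable (X t) := hX.comp measurable_prodMk_left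
  have hVt : Measurable (V t) := hV.comp measurable_prodMk_left
  have hvt : Measurable fun p : ℝ × ℝ => eulerianVelocity ν hν X V C t p.1 (X t p) :=
    measurable_eulerianVelocity.comp (measurable_const.prodMk (measurable_fst.prodMk hXt))
  rw [nuOtimes_eq_bindGraph] at hi ⊢
  rw [integral_bindGraph hν hfin (hi.bdd_mul (c := C) hVt.aestronglyMeasurable
      (Eventually.of_forall fun p => hVC t p)),
    integral_bindGraph hν hfin (hi.bdd_mul (c := C) hvt.aestronglyMeasurable
      (Eventually.of_forall fun p => abs_eulerianVelocity_le hC _ _ _))]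
  refine integral_congr_ae ?_
  filter_upwards [hfin, ae_integrable_of_integrable_bindGraph hν hfin hi] with a ha hia
  have h := integral_mul_eulerianVelocity (hν := hν) hX hV hC hVC ha t (ψ := fun y => Z (a, y))
    (hZ.comp measurable_prodMk_left) hia
  simpa only [mul_comm] using h

end FlowVelocity

theorem ae_solvesContinuity_pushFamily {μ : Measure ℝ} {ν : ℝ → Measure ℝ} {h : ℝ → ℝ} {R C T : ℝ}
    {X V : ℝ → ℝ × ℝ → ℝ} (hν : IsXR μ h R ν) (hX : Measurable fun p : ℝ × ℝ × ℝ => X p.1 p.2)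
    (hV : Measurable fun p : ℝ × ℝ × ℝ => V p.1 p.2) (hC : 0 ≤ C) (hVC : ∀ t p, |V t p| ≤ C)
    (hL : ∀ s t p, |X t p - X s p| ≤ C * |t - s|)
    (hXV : ∀ p, ∀ᵐ t, HasDerivAt (fun s => X s p) (V t p) t) (hT : 0 ≤ T) :
    ∀ᵐ a ∂μ, SolvesContinuity T (fun t => pushFamily ν (X t) a)
      fun t => eulerianVelocity ν hν.meas X V C t a := by
  filter_upwards [hν.mass_ne_top] with a ha
  have : IsFiniteMeasure (ν a) := ⟨lt_top_iff_ne_top.2 ha⟩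
  have hta : Measurable fun p : ℝ × ℝ => (p.1, a, p.2) :=
    measurable_fst.prodMk (measurable_const.prodMk measurable_snd)
  have hXa : Measurable fun p : ℝ × ℝ => X p.1 (a, p.2) := hX.comp hta
  have hVa : Measurable fun p : ℝ × ℝ => V p.1 (a, p.2) := hV.comp hta
  have hv : ∀ t, Measurable (eulerianVelocity ν hν.meas X V C t a) := fun t =>
    measurable_eulerianVelocity.comp
      (measurable_const.prodMk (measurable_const.prodMk measurable_id) :
        Measurable fun y : ℝ => (t, a, y))
  simp only [pushFamily_of_ne_top ha]
  exact solvesContinuity_of_flow (X := fun t x => X t (a, x)) (V := fun t x => V t (a, x)) hT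
    hXa hVa (fun t x => hVC t _) (fun s t x => hL s t _) (fun x => hXV _) hv
    (fun t y => abs_eulerianVelocity_le hC t a y)
    (fun t ψ hψ hi => integral_mul_eulerianVelocity hX hV hC hVC ha t hψ hi)

section Transfer

variable {μ : Measure ℝ} [SigmaFinite μ] {ν : ℝ → Measure ℝ} {h : ℝ → ℝ} {R C : ℝ}
  {X V : ℝ → ℝ × ℝ → ℝ} {β : ℝ × ℝ → ℝ}

theorem integral_sub_eulerianVelocity_mul (hν : IsXR μ h R ν)
    (hX : Measurable fun p : ℝ × ℝ × ℝ => X p.1 p.2)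
    (hV : Measurable fun p : ℝ × ℝ × ℝ => V p.1 p.2) (hC : 0 ≤ C) (hVC : ∀ t p, |V t p| ≤ C)
    (hβ : Measurable β) {B : ℝ} (hB : ∀ p, |β p| ≤ B) (hβfst : ∀ a x y, β (a, x) = β (a, y))
    (t : ℝ) {Z : ℝ × ℝ → ℝ} (hZ : Measurable Z)
    (hi : Integrable (fun p => Z (p.1, X t p)) (nuOtimes μ ν)) :
    ∫ p, (β p - eulerianVelocity ν hν.meas X V C t p.1 p.2) * Z p ∂(nuOtimes μ (pushFamily ν (X t)))
      = ∫ p, (β p - V t p) * Z (p.1, X t p) ∂(nuOtimes μ ν) := by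
  have hXt : Measurable (X t) := hX.comp measurable_prodMk_left
  have hVt : Measurable (V t) := hV.comp measurable_prodMk_left
  have hv : Measurable fun p : ℝ × ℝ => eulerianVelocity ν hν.meas X V C t p.1 p.2 :=
    measurable_eulerianVelocity.comp measurable_prodMk_left
  have hπ : Measurable fun p : ℝ × ℝ => (p.1, X t p) := measurable_fst.prodMk hXt
  have hm : Measurable fun p => (β p - eulerianVelocity ν hν.meas X V C t p.1 p.2) * Z p :=
    (hβ.sub hv).mul hZ
  rw [nuOtimes_pushFamily hν hXt, integral_map hπ.aemeasurable hm.aestronglyMeasurable]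
  have hβi : Integrable (fun p => β p * Z (p.1, X t p)) (nuOtimes μ ν) :=
    hi.bdd_mul (c := B) hβ.aestronglyMeasurable (Eventually.of_forall hB)
  have hVi : Integrable (fun p => V t p * Z (p.1, X t p)) (nuOtimes μ ν) :=
    hi.bdd_mul (c := C) hVt.aestronglyMeasurable (Eventually.of_forall fun p => hVC t p)
  have hvi : Integrable (fun p => eulerianVelocity ν hν.meas X V C t p.1 (X t p)
      * Z (p.1, X t p)) (nuOtimes μ ν) :=
    hi.bdd_mul (c := C) (hv.comp hπ).aestronglyMeasurable
      (Eventually.of_forall fun p => abs_eulerianVelocity_le hC _ _ _)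
  simp only [sub_mul]
  rw [integral_sub hβi hVi,
    integral_nuOtimes_mul_eulerianVelocity (hν := hν.meas) hX hV hC hVC hν.mass_ne_top t hZ hi,
    ← integral_sub hβi hvi]
  refine integral_congr_ae (Eventually.of_forall fun p => ?_)
  simp only [hβfst p.1 (X t p) p.2]

theorem isDominated_sub_eulerianVelocity [IsProbabilityMeasure (nuOtimes μ ν)] (hν : IsXR μ h R ν)
    (hX : Measurable fun p : ℝ × ℝ × ℝ => X p.1 p.2)
    (hV : Measurable fun p : ℝ × ℝ × ℝ => V p.1 p.2) (hC : 0 ≤ C) (hVC : ∀ t p, |V t p| ≤ C)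
    (hβ : Measurable β) {B : ℝ} (hB : ∀ p, |β p| ≤ B) (hβfst : ∀ a x y, β (a, x) = β (a, y))
    (t : ℝ) (hd : IsDominated (nuOtimes μ ν) fun p => β p - V t p) :
    IsDominated (nuOtimes μ (pushFamily ν (X t)))
      fun p => β p - eulerianVelocity ν hν.meas X V C t p.1 p.2 := by
  intro Z hZ hi
  have hXt : Measurable (X t) := hX.comp measurable_prodMk_left
  have hπ : Measurable fun p : ℝ × ℝ => (p.1, X t p) := measurable_fst.prodMk hXt
  rw [nuOtimes_pushFamily hν hXt, integrable_map_measure hZ.aestronglyMeasurable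
    hπ.aemeasurable] at hi
  rw [integral_sub_eulerianVelocity_mul hν hX hV hC hVC hβ hB hβfst t hZ hi,
    nuOtimes_pushFamily hν hXt, meanDiff_map hπ hZ]
  exact hd _ (hZ.comp hπ) hi

end Transfer

/-- The limit flow started from the disintegration `ν₀` yields a gradient flow of `Jen`. -/
theorem exists_gradient_flow_of_isProbabilityMeasure {Rx Rv : ℝ} (hRx : 0 < Rx) (hRv : 0 < Rv)
    {μ : Measure ℝ} [SigmaFinite μ] (hA : μ ((Set.Icc (-Rv) (Rv + 1))ᶜ) = 0)
    {h : ℝ → ℝ} (hh0 : ∀ a, 0 ≤ h a) (hhint : Integrable h μ)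
    {ν₀ : ℝ → Measure ℝ} (hν₀ : IsXR μ h Rx ν₀) [IsProbabilityMeasure (nuOtimes μ ν₀)]
    {T : ℝ} (hT : 0 < T) : ∃ R : ℝ, 0 < R ∧
      ∃ (ν : ℝ → ℝ → Measure ℝ) (v : ℝ → ℝ → ℝ → ℝ),
        IsGradientFlow μ h R T ν v ν₀ ∧
        ∀ᵐ t ∂(volume.restrict (Set.Icc (0 : ℝ) T)),
          ∀ᵐ p : ℝ × ℝ ∂(nuOtimes μ (ν t)),
            v t p.1 p.2 ∈ Set.Icc (p.1 - Gcdf μ (ν t) p.2) (p.1 - GcdfM μ (ν t) p.2) := by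
  set P := nuOtimes μ ν₀ with hP
  set β : ℝ × ℝ → ℝ := fun p => max (-Rv) (min p.1 (Rv + 1)) - 1 / 2 with hβdef
  set B : ℝ := Rv + 1 / 2 with hBdef
  have hB0 : 0 ≤ B := by positivity
  have hβ : Measurable β :=
    (measurable_const.max (measurable_fst.min measurable_const)).sub measurable_const
  have hB : ∀ p, |β p| ≤ B := fun p => by
    have h₁ : -Rv ≤ max (-Rv) (min p.1 (Rv + 1)) := le_max_left _ _
    have h₂ : max (-Rv) (min p.1 (Rv + 1)) ≤ Rv + 1 := max_le (by linarith) (min_le_right _ _)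
    exact abs_le.2 ⟨by simp only [hβdef, hBdef]; linarith, by simp only [hβdef, hBdef]; linarith⟩
  have hβfst : ∀ a x y, β (a, x) = β (a, y) := fun _ _ _ => rfl
  have hβa : ∀ᵐ a ∂μ, ∀ y, β (a, y) = a - 1 / 2 := by
    filter_upwards [mem_ae_iff.2 hA] with a ha y
    simp only [hβdef, min_eq_left ha.2, max_eq_right ha.1]
  have hM : ∀ᵐ a ∂μ, |a| ≤ Rv + 1 := by
    filter_upwards [mem_ae_iff.2 hA] with a ha
    exact abs_le.2 ⟨by linarith [ha.1], ha.2⟩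
  have hx : Measurable (Prod.snd : ℝ × ℝ → ℝ) := measurable_snd
  have hxi : Integrable (Prod.snd : ℝ × ℝ → ℝ) P :=
    .of_bound hx.aestronglyMeasurable Rx hν₀.ae_nuOtimes_abs_le
  set X := limitFlow P β Prod.snd with hXdef
  set V := flowVelocity X with hVdef
  set C : ℝ := B + 1 / 2 with hCdef
  have hC : 0 ≤ C := by positivity
  have hL : ∀ s t p, |X t p - X s p| ≤ C * |t - s| := abs_limitFlow_sub_le hB0 hB
  have hX : Measurable fun p : ℝ × ℝ × ℝ => X p.1 p.2 := measurable_uncurry_limitFlow hβ hx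
  have hXt : ∀ t, Measurable (X t) := measurable_limitFlow hβ hx
  have hV : Measurable fun p : ℝ × ℝ × ℝ => V p.1 p.2 := measurable_uncurry_flowVelocity hX
  have hVC : ∀ t p, |V t p| ≤ C := abs_flowVelocity_le hL
  have hX0 : X 0 = Prod.snd := limitFlow_zero P β Prod.snd
  set v := eulerianVelocity ν₀ hν₀.meas X V C with hvdef
  have hvm : Measurable fun p : ℝ × ℝ × ℝ => v p.1 p.2.1 p.2.2 := measurable_eulerianVelocity
  have hvC : ∀ t a y, |v t a y| ≤ C := abs_eulerianVelocity_le hC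
  have hvt : ∀ t, Measurable fun p : ℝ × ℝ => v t p.1 p.2 := fun t =>
    hvm.comp measurable_prodMk_left
  have hmem : ∀ t ∈ Set.Icc (0 : ℝ) T, IsXR μ h (Rx + C * T) (pushFamily ν₀ (X t)) := by
    intro t ht
    refine isXR_pushFamily hν₀ (hXt t) (r := C * T) (fun p => ?_) le_rfl
    have h₁ := hL 0 t p
    rw [hX0, sub_zero, abs_of_nonneg ht.1] at h₁
    exact h₁.trans (mul_le_mul_of_nonneg_left ht.2 hC)
  have hsub : ∀ᵐ t ∂(volume.restrict (Set.Icc (0 : ℝ) T)),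
      t ∈ Set.Icc (0 : ℝ) T ∧ IsDominated (nuOtimes μ (pushFamily ν₀ (X t)))
          (fun p => β p - v t p.1 p.2) ∧
        1 / 4 * meanDiff (nuOtimes μ (pushFamily ν₀ (X t))) Prod.snd
          ≤ ∫ p, (β p - v t p.1 p.2) * p.2 ∂(nuOtimes μ (pushFamily ν₀ (X t))) := by
    filter_upwards [ae_restrict_mem measurableSet_Icc,
      ae_restrict_of_ae (ae_subgradient_limitFlow hβ hB0 hB hx hxi)] with t ht hd
    obtain ⟨hd, hdX⟩ := hd ht.1
    have hπ : Measurable fun p : ℝ × ℝ => (p.1, X t p) := measurable_fst.prodMk (hXt t)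
    refine ⟨ht, isDominated_sub_eulerianVelocity hν₀ hX hV hC hVC hβ hB hβfst t hd, ?_⟩
    rw [hvdef, integral_sub_eulerianVelocity_mul hν₀ hX hV hC hVC hβ hB hβfst t hx
      (integrable_limitFlow hβ hB0 hB hx hxi t), nuOtimes_pushFamily hν₀ (hXt t),
      meanDiff_map hπ hx]
    exact hdX
  have hprob : ∀ t, IsProbabilityMeasure (nuOtimes μ (pushFamily ν₀ (X t))) := fun t => by
    rw [nuOtimes_pushFamily hν₀ (hXt t)]
    exact Measure.isProbabilityMeasure_map (measurable_fst.prodMk (hXt t)).aemeasurable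
  have hgm : ∀ t, Measurable fun p : ℝ × ℝ => β p - v t p.1 p.2 := fun t => hβ.sub (hvt t)
  have hgK : ∀ t p, |β p - v t p.1 p.2| ≤ B + C := fun t p =>
    (abs_sub _ _).trans (add_le_add (hB p) (hvC _ _ _))
  have hgw : ∀ t, ∀ᵐ a ∂μ, ∀ y, β (a, y) - v t a y = -v t a y + a - 1 / 2 := fun t =>
    hβa.mono fun a ha y => by rw [ha y]; ring
  refine ⟨Rx + C * T, by positivity, fun t => pushFamily ν₀ (X t), v,
    ⟨?_, hmem, ?_, hvm, ?_, ?_⟩, ?_⟩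
  · rw [hX0, pushFamily_snd]
  · refine ⟨√(∫ a, h a ∂μ) * C, fun s _ t _ => ?_⟩
    rw [mul_assoc, abs_sub_comm t s]
    exact sqrt_dsq_pushFamily_le hν₀ hh0 hhint (hXt s) (hXt t) (hL t s)
  · filter_upwards [hsub] with t ht
    have := hprob t
    exact inSubdiff_of_isDominated (hmem t ht.1) hM (hgm t) (hgK t) (hvt t).neg (hgw t)
      ht.2.1 ht.2.2
  · exact ae_solvesContinuity_pushFamily hν₀ hX hV hC hVC hL
      (ae_hasDerivAt_flowVelocity hC hL) hT.le
  · filter_upwards [hsub] with t ht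
    have := hprob t
    filter_upwards [ae_velocity_mem_Icc (w := fun a y => -v t a y) (hmem t ht.1) (hgm t) (hgK t)
      (hvt t).neg (hgw t) ht.2.1 ht.2.2] with p hp
    rwa [neg_neg] at hp

theorem measurable_label (f₀ : Measure (ℝ × ℝ)) [IsFiniteMeasure f₀] :
    Measurable fun p : ℝ × ℝ => (p.2 + (f₀ (Set.Iic p.1 ×ˢ Set.univ)).toReal, p.1) := by
  have hmono : Monotone fun x : ℝ => (f₀ (Set.Iic x ×ˢ Set.univ)).toReal := fun x y hxy =>
    ENNReal.toReal_mono (measure_ne_top _ _)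
      (measure_mono (Set.prod_mono (Set.Iic_subset_Iic.2 hxy) subset_rfl))
  exact (measurable_snd.add (hmono.measurable.comp measurable_fst)).prodMk measurable_fst

end GradientFlow

/-- **Main existence theorem** (Theorem `refexist`): let `f₀` be a compactly supported Borel
probability measure on `ℝ²` with `supp f₀ ⊂ B_{R_x} × B_{R_v}` and atomless spatial marginal,
`G₀(x) = f₀((−∞,x] × ℝ)`, `η₀` the push-forward of `f₀` by `(x,v) ↦ (v + G₀(x), x)` (label
first), `μ` a σ-finite measure on `A = [−R_v, R_v+1]` w.r.t. which the label marginal of `η₀`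
is absolutely continuous, and `ν₀ = (ν₀^a)` the disintegration `η₀ = ν₀^a ⊗ μ`. Then for every
`T > 0` there is `R > 0` and a gradient flow of `J` on `[0,T]` starting from `ν₀`; in
particular there exists a measure solution of the system `∂ₜν^a + ∂ₓ(ν^a v^a) = 0`,
`v_t^a(x) ∈ [a − G_t(x), a − G_t⁻(x)]`. -/
theorem exists_gradient_flow (Rx Rv : ℝ) (hRx : 0 < Rx) (hRv : 0 < Rv)
    (f₀ : Measure (ℝ × ℝ)) [IsProbabilityMeasure f₀]
    (hsupp : f₀ ((Set.Icc (-Rx) Rx ×ˢ Set.Icc (-Rv) Rv)ᶜ) = 0)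
    (hatomless : ∀ x : ℝ, f₀ ({x} ×ˢ (Set.univ : Set ℝ)) = 0)
    (μ : Measure ℝ) [SigmaFinite μ] (hA : μ ((Set.Icc (-Rv) (Rv + 1))ᶜ) = 0)
    (hac : (f₀.map fun p : ℝ × ℝ => p.2 + (f₀ (Set.Iic p.1 ×ˢ Set.univ)).toReal) ≪ μ)
    (h : ℝ → ℝ) (hh0 : ∀ a, 0 ≤ h a) (hhint : Integrable h μ)
    (ν₀ : ℝ → Measure ℝ) (hν₀ : IsXR μ h Rx ν₀)
    (hdis : nuOtimes μ ν₀ =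
      f₀.map fun p : ℝ × ℝ => (p.2 + (f₀ (Set.Iic p.1 ×ˢ Set.univ)).toReal, p.1)) :
    ∀ T : ℝ, 0 < T → ∃ R : ℝ, 0 < R ∧
      ∃ (ν : ℝ → ℝ → Measure ℝ) (v : ℝ → ℝ → ℝ → ℝ),
        IsGradientFlow μ h R T ν v ν₀ ∧
        ∀ᵐ t ∂(volume.restrict (Set.Icc (0 : ℝ) T)),
          ∀ᵐ p : ℝ × ℝ ∂(nuOtimes μ (ν t)),
            v t p.1 p.2 ∈ Set.Icc (p.1 - Gcdf μ (ν t) p.2) (p.1 - GcdfM μ (ν t) p.2) := by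
  intro T hT
  have : IsProbabilityMeasure (nuOtimes μ ν₀) := by
    rw [hdis]
    exact Measure.isProbabilityMeasure_map (measurable_label f₀).aemeasurable
  exact exists_gradient_flow_of_isProbabilityMeasure hRx hRv hA hh0 hhint hν₀ hT
end

section
/- Let T > 0 and for each a ∈ A let (t, x) ↦ ν_t^a be a family of C¹ (in (t,x)) nonnegative densities on [0,T] × ℝ solving ∂ₜν_t^a + ∂ₓ(ν_t^a (a − G_t(x))) = 0, where G_t(x) = ∫_A G_t^a(x) da and G_t^a(x) = ∫_{−∞}^x ν_t^a(y) dy, with all integrals finite and differentiation under the integral sign justified. Define m_t(x) = ∫_A (a − G_t(x)) ν_t^a(x) da. Then ∂ₜ G_t(x) = −m_t(x) for all (t, x) ∈ [0,T] × ℝ. -/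
open MeasureTheory

noncomputable section

/-- `G_t^a(x) = ∫_{−∞}^x ν_t^a(y) dy`, the cumulative distribution of the density `ν^a` at
time `t`. -/
def Ga (ν : ℝ → ℝ → ℝ → ℝ) (a t x : ℝ) : ℝ := ∫ y in Set.Iic x, ν a t y

/-- `G_t(x) = ∫_A G_t^a(x) da`. -/
def Gtot (A : Set ℝ) (ν : ℝ → ℝ → ℝ → ℝ) (t x : ℝ) : ℝ := ∫ a in A, Ga ν a t x

/-- The momentum `m_t(x) = ∫_A (a − G_t(x)) ν_t^a(x) da`. -/
def mfun (A : Set ℝ) (ν : ℝ → ℝ → ℝ → ℝ) (t x : ℝ) : ℝ :=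
  ∫ a in A, (a - Gtot A ν t x) * ν a t x

/-- **Key identity in the equivalence of the reformulation with the kinetic equation**
(paragraph `classic`): if for each label `a` the `C¹` nonnegative density `ν^a` solves the
continuity equation `∂ₜν^a + ∂ₓ(ν^a(a − G_t(x))) = 0` on `[0,T] × ℝ`, where
`G_t(x) = ∫_A G_t^a(x) da` and `G_t^a(x) = ∫_{−∞}^x ν_t^a(y) dy`, with all integrals finite
and differentiation under the integral sign justified (hypotheses `hνt`, `hFx`, `hder`),
then `∂ₜG_t(x) = −m_t(x)` where `m_t(x) = ∫_A (a − G_t(x)) ν_t^a(x) da`. -/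
theorem dt_G_eq_neg_momentum
    (A : Set ℝ) (hA : MeasurableSet A) (T : ℝ) (hT : 0 < T)
    (ν νt Fx : ℝ → ℝ → ℝ → ℝ)
    (hν0 : ∀ a t x, 0 ≤ ν a t x)
    (hC1 : ∀ a, ContDiff ℝ 1 fun p : ℝ × ℝ => ν a p.1 p.2)
    (hcs : ∀ a t, HasCompactSupport fun x => ν a t x)
    (hνt : ∀ a t x, HasDerivAt (fun s => ν a s x) (νt a t x) t)
    (hFx : ∀ a t x, HasDerivAt (fun y => ν a t y * (a - Gtot A ν t y)) (Fx a t x) x)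
    (hFxcont : ∀ a t, Continuous fun x => Fx a t x)
    (hpde : ∀ a : ℝ, ∀ t ∈ Set.Icc (0 : ℝ) T, ∀ x : ℝ, νt a t x + Fx a t x = 0)
    (hder : ∀ t ∈ Set.Icc (0 : ℝ) T, ∀ x : ℝ,
      HasDerivAt (fun s => Gtot A ν s x) (∫ a in A, ∫ y in Set.Iic x, νt a t y) t) :
    ∀ t ∈ Set.Icc (0 : ℝ) T, ∀ x : ℝ,
      HasDerivAt (fun s => Gtot A ν s x) (-(mfun A ν t x)) t := by
  intro t ht x
  have inner_eq (a : ℝ) :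
      ∫ y in Set.Iic x, νt a t y = -((a - Gtot A ν t x) * ν a t x) := by
    have hderiv : deriv (fun y => ν a t y * (a - Gtot A ν t y)) = Fx a t :=
      funext fun y => (hFx a t y).deriv
    have hflux : ContDiff ℝ 1 fun y => ν a t y * (a - Gtot A ν t y) := by
      rw [contDiff_one_iff_deriv, hderiv]
      exact ⟨fun y => (hFx a t y).differentiableAt, hFxcont a t⟩
    have hFTC := HasCompactSupport.integral_Iic_deriv_eq hflux (hcs a t).mul_right x
    rw [hderiv] at hFTC
    rw [funext fun y => eq_neg_of_add_eq_zero_left (hpde a t ht y), integral_neg, hFTC, mul_comm]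
  have h := hder t ht x
  simp only [inner_eq, integral_neg] at h
  exact h

end
end
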